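/- Let G = G_1 ∗ ⋯ ∗ G_n be a free product of finitely generated, freely indecomposable groups, and suppose for each i there is a real constant k_i ≥ 0 such that every injective endomorphism f of G_i has finitely generated fixed subgroup with rk(Fix(f)) ≤ k_i·rk(G_i). Then for every injective endomorphism φ of G, the fixed subgroup Fix(φ) is finitely generated and rk(Fix(φ)) ≤ n·(max_i k_i)·(rk(G) − n + 1). Moreover, if all the factors G_i have the same rank, then rk(Fix(φ)) ≤ (max_i k_i)·rk(G). -/

import Mathlib

/-- The fixed subgroup of an endomorphism. -/
def fixedSubgroup {G : Type*} [Group G] (φ : G →* G) : Subgroup G where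
  carrier := {g | φ g = g}
  one_mem' := by simp
  mul_mem' := by
    intro a b ha hb
    simp only [Set.mem_setOf_eq, map_mul] at *
    rw [ha, hb]
  inv_mem' := by
    intro a ha
    simp only [Set.mem_setOf_eq, map_inv] at *
    rw [ha]

/-- A group is freely indecomposable if it is nontrivial and not isomorphic to a free
product of two nontrivial groups. -/
def FreelyIndecomposable (G : Type u) [Group G] : Prop :=
  Nontrivial G ∧ ∀ (A B : Type u) (_ : Group A) (_ : Group B),
    Nontrivial A → Nontrivial B → ¬ Nonempty (G ≃* Monoid.Coprod A B)

section

open scoped ENNReal InnerProductSpace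

/-- The real Hilbert space of square summable functions on a set. -/
abbrev EllTwo (X : Type*) := lp (fun _ : X => ℝ) 2

namespace EllTwo

variable {X Y : Type*}

theorem sum_restrict_comp_sq_le (s : X → Prop) [DecidablePred s] (θ : X → Y)
    (hθ : ∀ x y, s x → s y → θ x = θ y → x = y) (b : EllTwo Y) (F : Finset X) :
    ∑ x ∈ F, ‖(if s x then b (θ x) else 0 : ℝ)‖ ^ (2 : ℝ≥0∞).toReal
      ≤ ‖b‖ ^ (2 : ℝ≥0∞).toReal := by
  classical
  have h1 : ∑ x ∈ F, ‖(if s x then b (θ x) else 0 : ℝ)‖ ^ (2 : ℝ≥0∞).toReal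
      = ∑ y ∈ (F.filter s).image θ, ‖b y‖ ^ (2 : ℝ≥0∞).toReal := by
    rw [Finset.sum_image, Finset.sum_filter]
    · refine Finset.sum_congr rfl fun x _ => ?_
      split_ifs <;> simp
    · intro x hx y hy h
      simp only [Finset.coe_filter, Set.mem_ofPred_eq] at hx hy
      exact hθ x y hx.2 hy.2 h
  rw [h1]
  exact lp.sum_rpow_le_norm_rpow (by simp) b _

/-- The partial composition operator `b ↦ (b ∘ θ) · 1_s`, for `θ` injective on `s`. -/
noncomputable def restrictComp (s : X → Prop) [DecidablePred s] (θ : X → Y)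
    (hθ : ∀ x y, s x → s y → θ x = θ y → x = y) : EllTwo Y →L[ℝ] EllTwo X :=
  LinearMap.mkContinuous
    { toFun := fun b => ⟨fun x => if s x then b (θ x) else 0,
        memℓp_gen' (C := ‖b‖ ^ (2 : ℝ≥0∞).toReal) (sum_restrict_comp_sq_le s θ hθ b)⟩
      map_add' := by
        intro b c
        ext x
        simp only [lp.coeFn_add, Pi.add_apply]
        split_ifs <;> simp
      map_smul' := by
        intro r b
        ext x
        simp } 1 (by
      intro b
      rw [one_mul]
      exact lp.norm_le_of_forall_sum_le (by simp) (norm_nonneg b)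
        (sum_restrict_comp_sq_le s θ hθ b))

theorem restrictComp_apply (s : X → Prop) [DecidablePred s] (θ : X → Y)
    (hθ : ∀ x y, s x → s y → θ x = θ y → x = y) (b : EllTwo Y) (x : X) :
    restrictComp s θ hθ b x = if s x then b (θ x) else 0 := rfl

theorem norm_restrictComp_le (s : X → Prop) [DecidablePred s] (θ : X → Y)
    (hθ : ∀ x y, s x → s y → θ x = θ y → x = y) (b : EllTwo Y) : ‖restrictComp s θ hθ b‖ ≤ ‖b‖ :=
  lp.norm_le_of_forall_sum_le (by simp) (norm_nonneg b) (sum_restrict_comp_sq_le s θ hθ b)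

/-- The basis vector at a point. -/
noncomputable def delta [DecidableEq X] (x : X) : EllTwo X := lp.single 2 x (1 : ℝ)

theorem delta_apply [DecidableEq X] (x y : X) : delta x y = if y = x then 1 else 0 := by
  unfold delta
  rw [lp.single_apply]
  simp [Pi.single_apply]

theorem inner_delta_left [DecidableEq X] (x : X) (b : EllTwo X) : ⟪delta x, b⟫_ℝ = b x := by
  unfold delta
  rw [lp.inner_single_left]
  simp

theorem inner_delta_right [DecidableEq X] (x : X) (b : EllTwo X) : ⟪b, delta x⟫_ℝ = b x := by
  rw [real_inner_comm, inner_delta_left]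

section Group

variable {G : Type*} [Group G] {ι κ : Type*} [DecidableEq κ]

/-- The operator `b ↦ ((g, j) ↦ ∑ₑ C j e * b (ψ g • e))`. -/
noncomputable def conv [Fintype κ] (ψ : G →* G) (hψ : Function.Injective ψ)
    (C : κ → (G × ι →₀ ℝ)) : EllTwo (G × ι) →L[ℝ] EllTwo (G × κ) :=
  ∑ j : κ, ∑ e ∈ (C j).support, C j e • restrictComp (fun x : G × κ => x.2 = j)
    (fun x => (ψ x.1 * e.1, e.2)) (by
      rintro ⟨g, i⟩ ⟨g', i'⟩ rfl hi' h
      simp only [Prod.mk.injEq, mul_left_inj, and_true] at h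
      rw [← hψ h]
      simpa using hi'.symm)

theorem conv_apply [Fintype κ] (ψ : G →* G) (hψ : Function.Injective ψ) (C : κ → (G × ι →₀ ℝ))
    (b : EllTwo (G × ι)) (g : G) (j : κ) :
    conv ψ hψ C b (g, j) = (C j).sum fun e r => r * b (ψ g * e.1, e.2) := by
  unfold conv
  simp only [sum_apply, lp.coeFn_sum, Finset.sum_apply,
    smul_apply, lp.coeFn_smul, Pi.smul_apply, restrictComp_apply]
  rw [Finset.sum_eq_single j]
  · simp [Finsupp.sum]
  · intro i _ hi
    simp [Ne.symm hi]
  · simp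

/-- Left translation. -/
noncomputable def translate (h : G) : EllTwo (G × ι) →L[ℝ] EllTwo (G × ι) :=
  restrictComp (fun _ => True) (fun x => (h * x.1, x.2)) (by
    rintro ⟨g, i⟩ ⟨g', i'⟩ - - h
    simpa using h)

theorem translate_apply (h : G) (b : EllTwo (G × ι)) (g : G) (i : ι) :
    translate h b (g, i) = b (h * g, i) := by
  simp [translate, restrictComp_apply]

theorem translate_translate (h k : G) (b : EllTwo (G × ι)) :
    translate h (translate k b) = translate (k * h) b := by
  ext ⟨g, i⟩
  simp [translate_apply, mul_assoc]

theorem translate_one (b : EllTwo (G × ι)) : translate 1 b = b := by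
  ext ⟨g, i⟩
  simp [translate_apply]

theorem norm_translate (h : G) (b : EllTwo (G × ι)) : ‖translate h b‖ = ‖b‖ := by
  refine le_antisymm (norm_restrictComp_le _ _ _ _) ?_
  conv_lhs => rw [← translate_one b, ← mul_inv_cancel h, ← translate_translate]
  exact norm_restrictComp_le _ _ _ _

theorem inner_translate (h : G) (a b : EllTwo (G × ι)) :
    ⟪translate h a, b⟫_ℝ = ⟪a, translate h⁻¹ b⟫_ℝ := by
  have key : ∀ a b : EllTwo (G × ι), ⟪translate h a, translate h b⟫_ℝ = ⟪a, b⟫_ℝ := by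
    intro a b
    have h1 := real_inner_eq_norm_add_mul_self_sub_norm_mul_self_sub_norm_mul_self_div_two
      (translate h a) (translate h b)
    rw [← map_add, norm_translate, norm_translate, norm_translate] at h1
    rw [h1, real_inner_eq_norm_add_mul_self_sub_norm_mul_self_sub_norm_mul_self_div_two]
  conv_rhs => rw [← key, translate_translate, inv_mul_cancel, translate_one]

theorem translate_delta [DecidableEq G] [DecidableEq ι] (h g : G) (i : ι) :
    translate h (delta (g, i)) = delta (h⁻¹ * g, i) := by
  ext ⟨g', i'⟩
  simp only [translate_apply, delta_apply, Prod.mk.injEq, eq_inv_mul_iff_mul_eq]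

theorem conv_translate [Fintype κ] (C : κ → (G × ι →₀ ℝ)) (h : G) (b : EllTwo (G × ι)) :
    conv (MonoidHom.id G) Function.injective_id C (translate h b) =
      translate h (conv (MonoidHom.id G) Function.injective_id C b) := by
  ext ⟨g, j⟩
  simp [conv_apply, translate_apply, mul_assoc]

/-- The von Neumann trace. -/
noncomputable def trace [DecidableEq G] [Fintype κ] (A : EllTwo (G × κ) →L[ℝ] EllTwo (G × κ)) : ℝ :=
  ∑ j : κ, A (delta (1, j)) (1, j)

/-- An operator commuting with left translations. -/
def Equivariant (A : EllTwo (G × κ) →L[ℝ] EllTwo (G × κ)) : Prop :=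
  ∀ h b, A (translate h b) = translate h (A b)

theorem Equivariant.hasSum_comp [DecidableEq G] {A B : EllTwo (G × κ) →L[ℝ] EllTwo (G × κ)}
    (hA : Equivariant A) (i : κ) :
    HasSum (fun x : G × κ => A (delta (1, x.2)) (x.1⁻¹, i) * B (delta (1, i)) x)
      (A (B (delta (1, i))) (1, i)) := by
  have h := lp.hasSum_inner (𝕜 := ℝ) (A.adjoint (delta (1, i))) (B (delta (1, i)))
  rw [ContinuousLinearMap.adjoint_inner_left, inner_delta_left] at h
  refine h.congr_fun ?_
  rintro ⟨g, j⟩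
  have h1 : A.adjoint (delta (1, i)) (g, j) = A (delta (1, j)) (g⁻¹, i) := by
    rw [← inner_delta_right, ContinuousLinearMap.adjoint_inner_left, inner_delta_left]
    have h2 := hA g⁻¹ (delta (1, j))
    rw [translate_delta, inv_inv, mul_one] at h2
    rw [h2, translate_apply, mul_one]
  rw [← h1]
  simp [mul_comm]

theorem trace_comp_comm [DecidableEq G] [Fintype κ]
    {A B : EllTwo (G × κ) →L[ℝ] EllTwo (G × κ)} (hA : Equivariant A) (hB : Equivariant B) :
    trace (A.comp B) = trace (B.comp A) := by
  have key : ∀ {A B : EllTwo (G × κ) →L[ℝ] EllTwo (G × κ)}, Equivariant A →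
      HasSum (fun g : G => ∑ i : κ, ∑ j : κ, A (delta (1, j)) (g⁻¹, i) * B (delta (1, i)) (g, j))
        (trace (A.comp B)) := by
    intro A B hA
    unfold trace
    refine hasSum_sum fun i _ => ?_
    have h := hA.hasSum_comp (B := B) i
    have h3 : Summable fun x : G × κ => A (delta (1, x.2)) (x.1⁻¹, i) * B (delta (1, i)) x :=
      h.summable
    exact h.prod_fiberwise fun g => hasSum_fintype _
  have h1 := key (B := B) hA
  have h2 := key (B := A) hB
  rw [← (Equiv.inv G).hasSum_iff] at h2
  refine h1.unique ?_
  convert h2 using 1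
  ext g
  simp only [Equiv.inv_apply, Function.comp_apply, inv_inv]
  rw [Finset.sum_comm]
  simp only [mul_comm]

end Group

end EllTwo

end

section

open scoped ENNReal InnerProductSpace Topology

namespace EllTwo

section Dimension

variable {G : Type*} [Group G] {ι κ : Type*}

/-- The orthogonal projection onto a translation invariant subspace is equivariant. -/
theorem equivariant_starProjection
    (K : Submodule ℝ (EllTwo (G × κ))) [K.HasOrthogonalProjection]
    (hK : ∀ h, ∀ x ∈ K, translate h x ∈ K) : Equivariant K.starProjection := by
  intro h b
  refine (Submodule.eq_starProjection_of_mem_orthogonal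
    (hK h _ (Submodule.starProjection_apply_mem _ _)) ?_)
  rw [Submodule.mem_orthogonal']
  intro u hu
  rw [← map_sub, inner_translate, Submodule.starProjection_inner_eq_zero]
  exact hK _ _ hu

variable [Fintype ι] [Fintype κ]

/-- The trace inequality for an equivariant idempotent. -/
theorem sum_one_sub_le_trace [DecidableEq G] [DecidableEq ι] [DecidableEq κ]
    {e : EllTwo (G × (ι ⊕ κ)) →L[ℝ] EllTwo (G × (ι ⊕ κ))}
    (he : Equivariant e) (hee : ∀ x, e (e x) = e x) (z : κ → EllTwo (G × (ι ⊕ κ)))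
    (hz : ∀ j, e (z j) = z j) :
    ∑ j, (1 - ‖delta (1, Sum.inr j) - z j‖ ^ 2) ≤ trace e := by
  let K : Submodule ℝ (EllTwo (G × (ι ⊕ κ))) :=
    LinearMap.ker (e - ContinuousLinearMap.id ℝ (EllTwo (G × (ι ⊕ κ)))).toLinearMap
  have memK : ∀ x, x ∈ K ↔ e x = x := by
    intro x
    simp [K, sub_eq_zero]
  have : CompleteSpace K := by
    have : IsClosed (K : Set (EllTwo (G × (ι ⊕ κ)))) :=
      ContinuousLinearMap.isClosed_ker _
    exact this.completeSpace_coe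
  set P := K.starProjection with hP
  have hPe : Equivariant P := by
    refine equivariant_starProjection K fun h x hx => ?_
    rw [memK] at hx ⊢
    rw [he, hx]
  have h1 : e.comp P = P := by
    ext1 x
    exact (memK _).1 (Submodule.starProjection_apply_mem _ _)
  have h2 : P.comp e = e := by
    ext1 x
    exact Submodule.starProjection_eq_self_iff.2 ((memK _).2 (hee x))
  have h3 : trace e = trace P := by
    rw [← h2, ← trace_comp_comm he hPe, h1]
  have hdiag : ∀ x : ι ⊕ κ, P (delta (1, x)) (1, x) = ‖P (delta (1, x))‖ ^ 2 := by
    intro x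
    rw [← inner_delta_left, ← real_inner_self_eq_norm_sq, hP,
      Submodule.inner_starProjection_left_eq_right, Submodule.starProjection_eq_self_iff.2
        (Submodule.starProjection_apply_mem K (delta (1, x)))]
  rw [h3]
  unfold trace
  rw [Fintype.sum_sum_type]
  have hnn : 0 ≤ ∑ i : ι, P (delta (1, Sum.inl i)) (1, Sum.inl i) :=
    Finset.sum_nonneg fun i _ => by rw [hdiag]; positivity
  refine le_trans (Finset.sum_le_sum fun j _ => ?_) (le_add_of_nonneg_left hnn)
  rw [hdiag]
  have hn : ‖(delta (1, Sum.inr j) : EllTwo (G × (ι ⊕ κ)))‖ ^ 2 = 1 := by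
    rw [← real_inner_self_eq_norm_sq, inner_delta_left, delta_apply, if_pos rfl]
  have hpy := Submodule.norm_sq_eq_add_norm_sq_starProjection
    (delta (1, Sum.inr j) : EllTwo (G × (ι ⊕ κ))) K
  have hmin : ‖delta (1, Sum.inr j) - P (delta (1, Sum.inr j))‖ ≤ ‖delta (1, Sum.inr j) - z j‖ := by
    rw [hP, Submodule.starProjection_minimal]
    exact ciInf_le ⟨0, by rintro _ ⟨y, rfl⟩; exact norm_nonneg _⟩ (⟨z j, (memK _).2 (hz j)⟩ : K)
  rw [hn, Submodule.starProjection_orthogonal_val] at hpy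
  have := pow_le_pow_left₀ (norm_nonneg _) hmin 2
  linarith

theorem card_le_of_denseRange [DecidableEq κ] (C : κ → (G × ι →₀ ℝ))
    (hT : DenseRange (conv (MonoidHom.id G) Function.injective_id C)) :
    Fintype.card κ ≤ Fintype.card ι := by
  classical
  set T := conv (MonoidHom.id G) Function.injective_id C with hTdef
  let inL : EllTwo (G × ι) →L[ℝ] EllTwo (G × (ι ⊕ κ)) :=
    conv (MonoidHom.id G) Function.injective_id (Sum.elim (fun i => Finsupp.single (1, i) 1) 0)
  let inR : EllTwo (G × κ) →L[ℝ] EllTwo (G × (ι ⊕ κ)) :=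
    conv (MonoidHom.id G) Function.injective_id (Sum.elim 0 (fun i => Finsupp.single (1, i) 1))
  have inLl : ∀ b g i, inL b (g, Sum.inl i) = b (g, i) := by
    intro b g i
    simp [inL, conv_apply]
  have inLr : ∀ b g j, inL b (g, Sum.inr j) = 0 := by
    intro b g i
    simp [inL, conv_apply]
  have inRl : ∀ b g i, inR b (g, Sum.inl i) = 0 := by
    intro b g i
    simp [inR, conv_apply]
  have inRr : ∀ b g j, inR b (g, Sum.inr j) = b (g, j) := by
    intro b g i
    simp [inR, conv_apply]
  let e : ℝ → EllTwo (G × (ι ⊕ κ)) →L[ℝ] EllTwo (G × (ι ⊕ κ)) := fun s =>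
    conv (MonoidHom.id G) Function.injective_id (Sum.elim (fun i => Finsupp.single (1, Sum.inl i) 1)
      (fun j => s • (C j).mapDomain (Prod.map id Sum.inl)))
  have hel : ∀ s b g i, e s b (g, Sum.inl i) = b (g, Sum.inl i) := by
    intro s b g i
    simp [e, conv_apply]
  have her : ∀ s b g j, e s b (g, Sum.inr j) =
      s * (C j).sum fun x r => r * b (g * x.1, Sum.inl x.2) := by
    intro s b g j
    simp only [e, conv_apply, Sum.elim_inr]
    rw [Finsupp.sum_smul_index (by simp), Finsupp.sum_mapDomain_index (by simp)
      (by intros; ring), Finsupp.mul_sum]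
    simp [mul_assoc]
  have step : ∀ (b : κ → EllTwo (G × ι)) (s : ℝ), s ≠ 0 →
      ∑ j, (1 - ‖delta (1, Sum.inr j) - (s⁻¹ • inL (b j) + inR (T (b j)))‖ ^ 2) ≤
        (Fintype.card ι : ℝ) := by
    intro b s hs
    refine (sum_one_sub_le_trace (e := e s) ?_ ?_ _ ?_).trans (le_of_eq ?_)
    · intro h x
      exact conv_translate _ _ _
    · intro x
      ext ⟨g, y⟩
      cases y with
      | inl i => simp [hel]
      | inr j => simp [hel, her]
    · intro j
      ext ⟨g, y⟩
      cases y with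
      | inl i =>
        rw [hel]
      | inr i =>
        rw [her]
        simp only [lp.coeFn_add, lp.coeFn_smul, Pi.add_apply, Pi.smul_apply, inLl, inLr, inRl,
          inRr, smul_eq_mul, mul_zero, add_zero, zero_add]
        simp only [T, conv_apply, Finsupp.mul_sum]
        refine Finsupp.sum_congr fun x _ => ?_
        simp only [MonoidHom.id_apply]
        field_simp
    · unfold trace
      rw [Fintype.sum_sum_type]
      simp only [hel, her, delta_apply]
      simp
  have step2 : ∀ b : κ → EllTwo (G × ι),
      ∑ j, (1 - ‖delta (1, Sum.inr j) - inR (T (b j))‖ ^ 2) ≤ (Fintype.card ι : ℝ) := by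
    intro b
    have ht : Filter.Tendsto (fun r : ℝ =>
        ∑ j, (1 - ‖delta (1, Sum.inr j) - (r • inL (b j) + inR (T (b j)))‖ ^ 2)) (𝓝[≠] 0)
        (𝓝 (∑ j, (1 - ‖delta (1, Sum.inr j) - ((0 : ℝ) • inL (b j) + inR (T (b j)))‖ ^ 2))) := by
      refine Filter.Tendsto.mono_left (Continuous.tendsto ?_ 0) nhdsWithin_le_nhds
      fun_prop
    simp only [zero_smul, zero_add] at ht
    refine le_of_tendsto ht ?_
    filter_upwards [self_mem_nhdsWithin] with r hr
    have := step b r⁻¹ (inv_ne_zero hr)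
    rwa [inv_inv] at this
  have step3 : ∀ y : κ → EllTwo (G × κ),
      ∑ j, (1 - ‖delta (1, Sum.inr j) - inR (y j)‖ ^ 2) ≤ (Fintype.card ι : ℝ) := by
    have hd : DenseRange (Pi.map fun _ : κ => T) := DenseRange.piMap fun _ => hT
    intro y
    refine hd.induction_on y (isClosed_le (by fun_prop) continuous_const) ?_
    exact step2
  have h4 := step3 fun j => delta (1, j)
  have h5 : ∀ j : κ, inR (delta (1, j)) = delta (1, Sum.inr j) := by
    intro j
    ext ⟨g, y⟩
    cases y <;> simp [inRl, inRr, delta_apply]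
  simp only [h5, sub_self, norm_zero] at h4
  simpa using h4

/-- If every finitely supported row is reproduced by an endomorphism, and the rows carry private
coordinates with respect to the periodic elements, then there are at most as many rows as
columns. -/
theorem card_le_of_private [DecidableEq G] [DecidableEq ι] [DecidableEq κ] (φ : G →* G)
    (hφ : Function.Injective φ)
    (C : κ → (G × ι →₀ ℝ)) (D : ι → (G × ι →₀ ℝ))
    (hCD : ∀ j, C j = (C j).sum fun e r =>
      r • (D e.2).mapDomain fun e' => (φ e.1 * e'.1, e'.2))
    (ε : κ → G × ι)
    (hpriv : ∀ g, (∃ m, 0 < m ∧ φ^[m] g = g) → ∀ i j,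
      C j (g * (ε i).1, (ε i).2) = if i = j ∧ g = 1 then 1 else 0) :
    Fintype.card κ ≤ Fintype.card ι := by
  refine card_le_of_denseRange C ?_
  set T := conv (MonoidHom.id G) Function.injective_id C with hTdef
  let R : EllTwo (G × κ) →L[ℝ] EllTwo (G × κ) := conv φ hφ fun j => Finsupp.single (1, j) 1
  have hR : ∀ b g j, R b (g, j) = b (φ g, j) := by
    intro b g j
    simp [R, conv_apply]
  have hRnorm : ∀ b, ‖R b‖ ≤ ‖b‖ := by
    intro b
    have : R b = restrictComp (fun _ => True) (fun x : G × κ => (φ x.1, x.2)) (by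
        rintro ⟨g, i⟩ ⟨g', i'⟩ - - h
        simpa [hφ.eq_iff] using h) b := by
      ext ⟨g, j⟩
      rw [hR, restrictComp_apply, if_pos trivial]
    rw [this]
    exact norm_restrictComp_le _ _ _ _
  have hRT : ∀ b, R (T b) = T (conv φ hφ D b) := by
    intro b
    ext ⟨g, j⟩
    rw [hR, hTdef, conv_apply, conv_apply]
    conv_lhs => rw [hCD j]
    rw [Finsupp.sum_sum_index (by simp) (by intros; ring)]
    refine Finsupp.sum_congr fun x _ => ?_
    rw [Finsupp.sum_smul_index (by simp), Finsupp.sum_mapDomain_index (by simp)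
      (by intros; ring)]
    simp only [MonoidHom.id_apply]
    rw [conv_apply, Finsupp.mul_sum]
    refine Finsupp.sum_congr fun y _ => ?_
    rw [map_mul]
    simp only [mul_assoc]
  set W : Submodule ℝ (EllTwo (G × κ)) := (LinearMap.range T.toLinearMap)ᗮ with hW
  have memW : ∀ x, x ∈ W ↔ ∀ b, ⟪x, T b⟫_ℝ = 0 := by
    intro x
    rw [hW, Submodule.mem_orthogonal']
    refine ⟨fun h b => h _ ⟨b, rfl⟩, ?_⟩
    rintro h _ ⟨b, rfl⟩
    exact h b
  have hWc : CompleteSpace W := (Submodule.isClosed_orthogonal _).completeSpace_coe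
  have : W.HasOrthogonalProjection := Submodule.HasOrthogonalProjection.ofCompleteSpace W
  have hadj : ∀ x ∈ W, R.adjoint x ∈ W := by
    intro x hx
    rw [memW] at hx ⊢
    intro b
    rw [ContinuousLinearMap.adjoint_inner_left, hRT, hx]
  have hzero : ∀ i, ∀ x ∈ W, x (1, i) = 0 := by
    intro i
    set a := W.starProjection (delta (1, i)) with ha
    have haW : a ∈ W := Submodule.starProjection_apply_mem _ _
    have hax : ∀ x ∈ W, ⟪a, x⟫_ℝ = x (1, i) := by
      intro x hx
      rw [ha, Submodule.inner_starProjection_left_eq_right,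
        Submodule.starProjection_eq_self_iff.2 hx, inner_delta_left]
    have hPR : W.starProjection (R a) = a := by
      refine ext_inner_right ℝ fun v => ?_
      have h1 : ∀ v ∈ W, ⟪W.starProjection (R a), v⟫_ℝ = ⟪a, v⟫_ℝ := by
        intro v hv
        rw [Submodule.inner_starProjection_left_eq_right,
          Submodule.starProjection_eq_self_iff.2 hv, ← ContinuousLinearMap.adjoint_inner_right,
          hax _ (hadj v hv), hax v hv, ← inner_delta_left, ContinuousLinearMap.adjoint_inner_right]
        have : R (delta (1, i)) = delta (1, i) := by
          ext ⟨g, j⟩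
          rw [hR, delta_apply, delta_apply]
          simp only [Prod.mk.injEq, map_eq_one_iff φ hφ]
        rw [this, inner_delta_left]
      have h2 := h1 (W.starProjection v) (Submodule.starProjection_apply_mem _ _)
      rwa [← Submodule.inner_starProjection_left_eq_right,
        ← Submodule.inner_starProjection_left_eq_right, Submodule.starProjection_eq_self_iff.2
        (Submodule.starProjection_apply_mem _ _), Submodule.starProjection_eq_self_iff.2 haW] at h2
    have hRa : R a = a := by
      have h1 := Submodule.norm_sq_eq_add_norm_sq_starProjection (R a) W
      rw [hPR, Submodule.starProjection_orthogonal_val, hPR] at h1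
      have h2 := pow_le_pow_left₀ (norm_nonneg _) (hRnorm a) 2
      have h3 : ‖R a - a‖ ^ 2 ≤ 0 := by linarith
      have h4 : ‖R a - a‖ = 0 := by
        have := sq_nonneg ‖R a - a‖
        exact pow_eq_zero_iff two_ne_zero |>.1 (le_antisymm h3 this)
      exact sub_eq_zero.1 (norm_eq_zero.1 h4)
    have hinv : ∀ n g j, a (φ^[n] g, j) = a (g, j) := by
      intro n
      induction n with
      | zero => simp
      | succ n ih =>
        intro g j
        rw [Function.iterate_succ_apply, ih, ← hR, hRa]
    have hsupp : ∀ g, (¬ ∃ m, 0 < m ∧ φ^[m] g = g) → ∀ j, a (g, j) = 0 := by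
      intro g hg j
      by_contra hne
      have hinj : Function.Injective fun n : ℕ => ((φ^[n] g, j) : G × κ) := by
        intro m n hmn
        simp only [Prod.mk.injEq, and_true] at hmn
        by_contra hmn'
        rcases lt_or_gt_of_ne hmn' with h | h
        · refine hg ⟨n - m, by omega, ?_⟩
          apply hφ.iterate m
          rw [← Function.iterate_add_apply, Nat.add_sub_cancel' h.le, hmn]
        · refine hg ⟨m - n, by omega, ?_⟩
          apply hφ.iterate n
          rw [← Function.iterate_add_apply, Nat.add_sub_cancel' h.le, hmn]
      have hs : Summable fun x : G × κ => ‖a x‖ ^ (2 : ℝ≥0∞).toReal :=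
        (lp.memℓp a).summable (by simp)
      have hs2 := hs.comp_injective hinj
      have : (fun n : ℕ => ‖a (g, j)‖ ^ (2 : ℝ≥0∞).toReal) =
          (fun x : G × κ => ‖a x‖ ^ (2 : ℝ≥0∞).toReal) ∘ fun n : ℕ => ((φ^[n] g, j) : G × κ) := by
        ext n
        simp only [Function.comp_apply, hinv]
      rw [← this, summable_const_iff] at hs2
      simp at hs2
      exact hne hs2
    have hTd : ∀ g j, T (delta ((ε i).1, (ε i).2)) (g, j) = C j (g⁻¹ * (ε i).1, (ε i).2) := by
      intro g j
      rw [hTdef, conv_apply, Finsupp.sum_eq_single (g⁻¹ * (ε i).1, (ε i).2)]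
      · simp [delta_apply]
      · rintro ⟨x, y⟩ _ hne
        rw [delta_apply, if_neg, mul_zero]
        intro h
        apply hne
        simp only [MonoidHom.id_apply, Prod.mk.injEq] at h
        rw [← h.1, ← h.2, inv_mul_cancel_left]
      · simp
    have ha1 : a (1, i) = 0 := by
      have h1 := (memW a).1 haW (delta ((ε i).1, (ε i).2))
      have h2 : HasSum (fun x : G × κ => ⟪a x, T (delta ((ε i).1, (ε i).2)) x⟫_ℝ) (a (1, i)) := by
        have : (fun x : G × κ => ⟪a x, T (delta ((ε i).1, (ε i).2)) x⟫_ℝ) =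
            fun x => if x = (1, i) then a (1, i) else 0 := by
          ext ⟨g, j⟩
          simp only [RCLike.inner_apply, conj_trivial]
          by_cases hg : ∃ m, 0 < m ∧ φ^[m] g = g
          · have hg' : ∃ m, 0 < m ∧ φ^[m] g⁻¹ = g⁻¹ := by
              obtain ⟨m, hm, h⟩ := hg
              exact ⟨m, hm, by rw [iterate_map_inv, h]⟩
            rw [hTd, hpriv _ hg']
            by_cases h : i = j ∧ g = 1
            · obtain ⟨rfl, rfl⟩ := h
              simp
            · rw [if_neg, if_neg, zero_mul]
              · rintro ⟨⟩
                exact h ⟨rfl, rfl⟩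
              · simpa using h
          · rw [hsupp g hg, mul_zero, if_neg]
            rintro ⟨⟩
            exact hg ⟨1, one_pos, by simp⟩
        rw [this]
        exact hasSum_ite_eq _ _
      rw [← h1]
      exact h2.unique (lp.hasSum_inner _ _)
    have ha0 : a = 0 := by
      have := hax a haW
      rw [ha1] at this
      exact inner_self_eq_zero.1 this
    intro x hx
    rw [← hax x hx, ha0, inner_zero_left]
  have hWbot : W = ⊥ := by
    rw [Submodule.eq_bot_iff]
    intro x hx
    ext ⟨g, j⟩
    have h1 : translate g x ∈ W := by
      rw [memW] at hx ⊢
      intro b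
      rw [inner_translate, hTdef, ← conv_translate, hx]
    have := hzero j _ h1
    rwa [translate_apply, mul_one] at this
  have h := Submodule.topologicalClosure_eq_top_iff.2 hWbot
  rw [DenseRange, dense_iff_closure_eq]
  have h2 := congrArg (fun S : Submodule ℝ (EllTwo (G × κ)) => (S : Set (EllTwo (G × κ)))) h
  exact h2

end Dimension

end EllTwo

end

/-- The edges of a tree with free edge orbits indexed by `ι`. -/
@[ext]
structure Edge (G ι : Type*) where
  /-- The group element locating the edge in its orbit. -/
  fst : G
  /-- The orbit of the edge. -/
  snd : ι

instance {G ι : Type*} [Group G] : MulAction G (Edge G ι) where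
  smul g e := ⟨g * e.1, e.2⟩
  one_smul e := Edge.ext (one_mul e.1) rfl
  mul_smul g h e := Edge.ext (mul_assoc g h e.1) rfl

namespace Edge

variable {G ι : Type*} [Group G]

theorem smul_mk_one (e : Edge G ι) : e.1 • (⟨1, e.2⟩ : Edge G ι) = e :=
  Edge.ext (mul_one e.1) rfl

theorem smul_right_injective (e : Edge G ι) : Function.Injective fun g : G => g • e := by
  intro g h hgh
  exact mul_right_cancel (congrArg Edge.fst hgh)

theorem smul_eq_self_iff {g : G} {e : Edge G ι} : g • e = e ↔ g = 1 :=
  ⟨fun h => smul_right_injective e (by simpa using h), by rintro rfl; simp⟩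

end Edge

/-- A tree on the vertex set `V` on which `G` acts with free edge orbits `{g • o, g • w i}`,
encoded by the geodesic cocycle `c`. -/
structure EquivariantTree (G V ι : Type*) [Group G] [MulAction G V] where
  /-- The base vertex. -/
  o : V
  /-- The end points of the edges starting at the base vertex. -/
  w : ι → V
  /-- The signed geodesic between two vertices. -/
  c : V → V → Edge G ι →₀ ℤ
  c_add : ∀ x y z, c x y + c y z = c x z
  c_smul : ∀ (g : G) x y e, c (g • x) (g • y) (g • e) = c x y e
  c_tip : ∀ i, c o (w i) = Finsupp.single ⟨1, i⟩ 1
  conn : ∀ P : V → Prop, (∀ (g : G) i, P (g • o) ↔ P (g • w i)) → P o → ∀ x, P x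
  free : ∀ g : G, g • o = o → g = 1

namespace EquivariantTree

variable {G V ι : Type*} [Group G] [MulAction G V] (T : EquivariantTree G V ι)

/-- The source of an edge. -/
def src (e : Edge G ι) : V := e.1 • T.o

/-- The target of an edge. -/
def tgt (e : Edge G ι) : V := e.1 • T.w e.2

theorem src_smul (g : G) (e : Edge G ι) : T.src (g • e) = g • T.src e := mul_smul _ _ _

theorem tgt_smul (g : G) (e : Edge G ι) : T.tgt (g • e) = g • T.tgt e := mul_smul _ _ _

theorem c_self (x : V) : T.c x x = 0 := by
  simpa using T.c_add x x x

theorem c_symm (x y : V) : T.c y x = -T.c x y := by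
  rw [eq_neg_iff_add_eq_zero, T.c_add, T.c_self]

theorem c_smul_apply (g : G) (x y : V) (e : Edge G ι) :
    T.c (g • x) (g • y) e = T.c x y (g⁻¹ • e) := by
  rw [← T.c_smul g x y, smul_inv_smul]

theorem c_edge (e : Edge G ι) : T.c (T.src e) (T.tgt e) = Finsupp.single e 1 := by
  classical
  ext e'
  unfold src tgt
  rw [c_smul_apply, c_tip, Finsupp.single_apply, Finsupp.single_apply]
  congr 1
  rw [eq_iff_iff, eq_inv_smul_iff, Edge.smul_mk_one]

/-- The boundary formula. -/
theorem sub_eq_sum {M : Type*} [AddCommGroup M] (s : V → M) (x y : V) :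
    s y - s x = (T.c x y).sum fun e n => n • (s (T.tgt e) - s (T.src e)) := by
  have key : ∀ y, s y - s T.o =
      (T.c T.o y).sum fun e n => n • (s (T.tgt e) - s (T.src e)) := by
    refine T.conn _ (fun g i => ?_) (by simp [T.c_self])
    have h1 := T.c_add T.o (g • T.o) (g • T.w i)
    have h2 := T.c_edge ⟨g, i⟩
    change T.c (g • T.o) (g • T.w i) = _ at h2
    rw [← h1, Finsupp.sum_add_index' (by simp) (by intros; rw [add_smul]), h2,
      Finsupp.sum_single_index (by simp), one_smul]
    change _ ↔ _ = _ + (s (g • T.w i) - s (g • T.o))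
    rw [← sub_eq_iff_eq_add]
    simp
  have h := T.c_add T.o x y
  rw [← sub_sub_sub_cancel_right _ _ (s T.o), key y, key x, ← h,
    Finsupp.sum_add_index' (by simp) (by intros; rw [add_smul])]
  abel

/-- A function which is constant across the edges of a geodesic agrees at its end points. -/
theorem eq_of_forall_edge {α : Type*} (s : V → α) {x y : V}
    (h : ∀ e, T.c x y e ≠ 0 → s (T.src e) = s (T.tgt e)) : s x = s y := by
  classical
  by_contra hne
  have h1 := T.sub_eq_sum (fun z => if s z = s y then (1 : ℤ) else 0) x y
  rw [if_pos rfl, if_neg hne, Finsupp.sum, Finset.sum_eq_zero] at h1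
  · simp at h1
  · intro e he
    rw [h e (by simpa using he), sub_self, smul_zero]

theorem eq_of_c_eq_zero {x y : V} (h : T.c x y = 0) : x = y :=
  T.eq_of_forall_edge id fun e he => (he (by simp [h])).elim

/-- The geodesic between two vertices has all its edges in a given set. -/
def Joined (F : Set (Edge G ι)) (x y : V) : Prop := ∀ e, T.c x y e ≠ 0 → e ∈ F

variable {T}

theorem Joined.refl (F : Set (Edge G ι)) (x : V) : T.Joined F x x := fun e h => by
  simp [T.c_self] at h

theorem Joined.symm {F : Set (Edge G ι)} {x y : V} (h : T.Joined F x y) : T.Joined F y x :=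
  fun e he => h e (by rw [T.c_symm] at he; simpa using he)

theorem Joined.trans {F : Set (Edge G ι)} {x y z : V} (h : T.Joined F x y)
    (h' : T.Joined F y z) : T.Joined F x z := by
  intro e he
  by_contra hF
  apply he
  have h1 : T.c x y e = 0 := by_contra fun h1 => hF (h e h1)
  have h2 : T.c y z e = 0 := by_contra fun h1 => hF (h' e h1)
  rw [← T.c_add x y z, Finsupp.add_apply, h1, h2, add_zero]

theorem Joined.mono {F F' : Set (Edge G ι)} {x y : V} (h : T.Joined F x y) (hF : F ⊆ F') :
    T.Joined F' x y := fun e he => hF (h e he)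

theorem joined_edge {F : Set (Edge G ι)} {e : Edge G ι} (he : e ∈ F) :
    T.Joined F (T.src e) (T.tgt e) := by
  classical
  intro e' h
  rw [T.c_edge, Finsupp.single_apply] at h
  split_ifs at h with h1
  · exact h1 ▸ he
  · simp at h

theorem Joined.smul {F : Set (Edge G ι)} {x y : V} (h : T.Joined F x y) {g : G}
    (hF : ∀ e ∈ F, g • e ∈ F) : T.Joined F (g • x) (g • y) := by
  intro e he
  rw [T.c_smul_apply] at he
  simpa using hF _ (h _ he)

theorem c_apply_eq_zero_of_joined {F : Set (Edge G ι)} {x y : V} (h : T.Joined F x y)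
    {e : Edge G ι} (he : e ∉ F) : T.c x y e = 0 := by_contra fun h1 => he (h e h1)

end EquivariantTree

/-- A sum of a function with values mod `p` invariant under a permutation of order dividing `p`
localizes to the fixed points. -/
theorem Finset.sum_eq_sum_fixed {X : Type*} [DecidableEq X] (p : ℕ) [hp : Fact p.Prime]
    (σ : X → X) (hσ : ∀ x, σ^[p] x = x) (S : Finset X) (hS : ∀ x ∈ S, σ x ∈ S)
    (F : X → ZMod p) (hF : ∀ x, F (σ x) = F x) :
    ∑ x ∈ S, F x = ∑ x ∈ S with σ x = x, F x := by
  classical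
  have h1 : ∀ S' : Finset X, ∑ x ∈ S', F x =
      ∑ v : ZMod p, ((S'.filter (F · = v)).card : ZMod p) * v := by
    intro S'
    rw [← Finset.sum_fiberwise S' F]
    refine Finset.sum_congr rfl fun v _ => ?_
    rw [Finset.sum_congr rfl (g := fun _ => v) (by simp), Finset.sum_const, nsmul_eq_mul]
  rw [h1, h1]
  refine Finset.sum_congr rfl fun v _ => ?_
  congr 1
  have hmem : ∀ x : {x // x ∈ S.filter (F · = v)}, σ x.1 ∈ S.filter (F · = v) := by
    rintro ⟨x, hx⟩
    simp only [Finset.mem_filter] at hx ⊢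
    exact ⟨hS x hx.1, by rw [hF, hx.2]⟩
  let f : Function.End {x // x ∈ S.filter (F · = v)} := fun x => ⟨σ x.1, hmem x⟩
  have hf : f ^ p ^ 1 = 1 := by
    have : ∀ (n : ℕ) x, ((f ^ n : Function.End _) x).1 = σ^[n] x.1 := by
      intro n
      induction n with
      | zero => intro x; rfl
      | succ n ih =>
        intro x
        rw [pow_succ]
        change ((f ^ n : Function.End _) (f x)).1 = _
        rw [ih]
        rfl
    funext x
    apply Subtype.ext
    rw [pow_one, this, hσ]
    rfl
  have h2 := Equiv.Perm.card_fixedPoints_modEq hf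
  rw [← ZMod.natCast_eq_natCast_iff, Fintype.card_coe] at h2
  rw [h2]
  congr 1
  rw [← Fintype.card_coe]
  refine Fintype.card_congr ⟨fun x => ⟨x.1.1, ?_⟩, fun x => ⟨⟨x.1, ?_⟩, ?_⟩, fun _ => rfl,
    fun _ => rfl⟩
  · have hx := x.1.2
    have hx2 : σ x.1.1 = x.1.1 := congrArg Subtype.val x.2
    simp only [Finset.mem_filter] at hx ⊢
    exact ⟨⟨hx.1, hx2⟩, hx.2⟩
  · have hx := x.2
    simp only [Finset.mem_filter] at hx ⊢
    exact ⟨hx.1.1, hx.2⟩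
  · have hx := x.2
    simp only [Finset.mem_filter] at hx
    exact Subtype.ext hx.1.2

namespace EquivariantTree

variable {G V ι : Type*} [Group G] [MulAction G V] {T : EquivariantTree G V ι}

theorem eq_of_smul_eq (T : EquivariantTree G V ι) {g : G} (hg : g ≠ 1) {x y : V}
    (hx : g • x = x) (hy : g • y = y) :
    x = y := by
  classical
  by_cases hfin : IsOfFinOrder g
  · by_contra hne
    set p := (orderOf g).minFac with hp
    have hg1 : orderOf g ≠ 1 := by simpa using hg
    have : Fact p.Prime := ⟨Nat.minFac_prime hg1⟩
    set h := g ^ (orderOf g / p) with hh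
    have hord : orderOf h = p := by
      rw [hh]
      exact orderOf_pow_orderOf_div hfin.orderOf_pos.ne' (Nat.minFac_dvd _)
    have hfix : ∀ (n : ℕ) (z : V), g • z = z → g ^ n • z = z := by
      intro n z hz
      induction n with
      | zero => simp
      | succ n ih => rw [pow_succ, mul_smul, hz, ih]
    have hhx : h • x = x := hfix _ _ hx
    have hhy : h • y = y := hfix _ _ hy
    have hc : ∀ e, T.c x y (h • e) = T.c x y e := by
      intro e
      rw [← T.c_smul h x y e, hhx, hhy]
    have hs : ∀ z, (if h • z = y then (1 : ℤ) else 0) = if z = y then 1 else 0 := by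
      intro z
      congr 1
      rw [smul_eq_iff_eq_inv_smul, inv_smul_eq_iff.2 hhy.symm]
    have hsum := T.sub_eq_sum (fun z => if z = y then (1 : ℤ) else 0) x y
    rw [if_pos rfl, if_neg hne, Finsupp.sum] at hsum
    have h2 := Finset.sum_eq_sum_fixed p (fun e : Edge G ι => h • e) (fun e => by
      rw [smul_iterate, ← hord, pow_orderOf_eq_one]
      exact one_smul _ _) (T.c x y).support (by
      intro e he
      simpa [hc] using he)
      (fun e => (((T.c x y) e • ((if T.tgt e = y then (1 : ℤ) else 0) -
        if T.src e = y then 1 else 0) : ℤ) : ZMod p)) (by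
      intro e
      simp only [T.tgt_smul, T.src_smul, hs, hc])
    rw [← Int.cast_sum, ← hsum, Finset.sum_eq_zero] at h2
    · simp at h2
    · intro e he
      simp only [Finset.mem_filter, Edge.smul_eq_self_iff] at he
      rw [he.2, orderOf_one] at hord
      exact ((Fact.out : p.Prime).one_lt.ne hord).elim
  · apply T.eq_of_c_eq_zero
    ext e
    by_contra hne
    have hc : ∀ n : ℕ, T.c x y (g ^ n • e) = T.c x y e := by
      intro n
      induction n with
      | zero => simp
      | succ n ih =>
        have := T.c_smul g x y (g ^ n • e)
        rwa [hx, hy, ih, smul_smul, ← pow_succ'] at this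
    refine (T.c x y).support.finite_toSet.not_infinite
      (Set.infinite_of_injective_forall_mem (f := fun n : ℕ => g ^ n • e) ?_ ?_)
    · intro m n hmn
      exact injective_pow_iff_not_isOfFinOrder.2 hfin (Edge.smul_right_injective e hmn)
    · intro n
      simpa [hc] using hne

variable (T)

/-- A set of edges along which every vertex is joined to at most one marked vertex, and all of
whose edges are joined to marked vertices. -/
structure IsMarkedForest (K : Subgroup G) (A : Set (Edge G ι)) (U : Set V)
    (F : Set (Edge G ι)) : Prop where
  subset : F ⊆ A
  smul_mem : ∀ κ ∈ K, ∀ e ∈ F, κ • e ∈ F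
  eq_of_joined : ∀ u ∈ U, ∀ v ∈ U, T.Joined F u v → u = v
  exists_joined : ∀ e ∈ F, ∃ u ∈ U, T.Joined F u (T.src e)

variable {T} {K : Subgroup G} {A : Set (Edge G ι)} {U : Set V} {F : Set (Edge G ι)}

theorem IsMarkedForest.insert_orbit (hF : T.IsMarkedForest K A U F)
    (hA : ∀ κ ∈ K, ∀ e ∈ A, κ • e ∈ A) (hU : ∀ κ ∈ K, ∀ u ∈ U, κ • u ∈ U)
    (hstab : ∀ x ∉ U, ∀ κ ∈ K, κ • x = x → κ = 1) {e : Edge G ι} (heA : e ∈ A) {y m : V}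
    (hym : (y = T.src e ∧ m = T.tgt e) ∨ (y = T.tgt e ∧ m = T.src e))
    (hm : ∃ u ∈ U, T.Joined F u m) (hy : ¬ ∃ u ∈ U, T.Joined F u y) :
    T.IsMarkedForest K A U (F ∪ {e' | ∃ κ ∈ K, e' = κ • e}) := by
  classical
  set F' := F ∪ {e' | ∃ κ ∈ K, e' = κ • e} with hF'
  have hmove : ∀ κ ∈ K, ∀ z, (∃ u ∈ U, T.Joined F u z) → ∃ u ∈ U, T.Joined F u (κ • z) := by
    rintro κ hκ z ⟨u, hu, h⟩
    exact ⟨κ • u, hU κ hκ u hu, h.smul (hF.smul_mem κ hκ)⟩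
  have hy' : ∀ κ ∈ K, ¬ ∃ u ∈ U, T.Joined F u (κ • y) := by
    intro κ hκ h
    have := hmove κ⁻¹ (inv_mem hκ) _ h
    rw [inv_smul_smul] at this
    exact hy this
  have hyU : y ∉ U := fun h => hy ⟨y, h, Joined.refl F y⟩
  have hends : ∀ e' ∈ F, (∃ u ∈ U, T.Joined F u (T.src e')) ∧ ∃ u ∈ U, T.Joined F u (T.tgt e') := by
    intro e' he'
    obtain ⟨u, hu, h⟩ := hF.exists_joined e' he'
    exact ⟨⟨u, hu, h⟩, u, hu, h.trans (joined_edge he')⟩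
  refine ⟨?_, ?_, ?_, ?_⟩
  · rintro e' (h | ⟨κ, hκ, rfl⟩)
    · exact hF.subset h
    · exact hA κ hκ e heA
  · rintro κ hκ e' (h | ⟨κ', hκ', rfl⟩)
    · exact Or.inl (hF.smul_mem κ hκ e' h)
    · exact Or.inr ⟨κ * κ', mul_mem hκ hκ', (mul_smul _ _ _).symm⟩
  · intro u hu v hv huv
    refine hF.eq_of_joined u hu v hv fun e' he' => ?_
    rcases huv e' he' with h | ⟨κ, hκ, rfl⟩
    · exact h
    exfalso
    apply he'
    have hsum := T.sub_eq_sum (fun z => if z = κ • y then (1 : ℤ) else 0) u v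
    rw [if_neg, if_neg, Finsupp.sum, Finset.sum_eq_single (κ • e)] at hsum
    · rcases hym with ⟨h1, h2⟩ | ⟨h1, h2⟩
      · rw [T.tgt_smul, T.src_smul, ← h1, ← h2, if_neg, if_pos rfl] at hsum
        · simpa using hsum
        · intro h
          rw [smul_left_cancel_iff] at h
          exact hy (h ▸ hm)
      · rw [T.tgt_smul, T.src_smul, ← h1, ← h2, if_pos rfl, if_neg] at hsum
        · simpa using hsum.symm
        · intro h
          rw [smul_left_cancel_iff] at h
          exact hy (h ▸ hm)
    · intro e'' he'' hne
      rcases huv e'' (by simpa using he'') with h | ⟨κ', hκ', rfl⟩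
      · rw [if_neg, if_neg, sub_self, smul_zero]
        · intro h'
          exact hy' κ hκ (h' ▸ (hends e'' h).1)
        · intro h'
          exact hy' κ hκ (h' ▸ (hends e'' h).2)
      · have hκκ : κ' • y ≠ κ • y := by
          intro h
          rw [← inv_smul_eq_iff, smul_smul] at h
          have := hstab y hyU _ (mul_mem (inv_mem hκ) hκ') h
          rw [inv_mul_eq_one] at this
          exact hne (by rw [this])
        have hκm : κ' • m ≠ κ • y := by
          intro h
          exact hy' κ hκ (h ▸ hmove κ' hκ' m hm)
        rcases hym with ⟨h1, h2⟩ | ⟨h1, h2⟩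
        · rw [T.tgt_smul, T.src_smul, ← h1, ← h2, if_neg hκκ, if_neg hκm, sub_self, smul_zero]
        · rw [T.tgt_smul, T.src_smul, ← h1, ← h2, if_neg hκκ, if_neg hκm, sub_self, smul_zero]
    · intro h
      simp [Finsupp.notMem_support_iff.1 h]
    · rintro rfl
      exact hy' κ hκ ⟨_, hu, Joined.refl F _⟩
    · rintro rfl
      exact hy' κ hκ ⟨_, hv, Joined.refl F _⟩
  · rintro e' (h | ⟨κ, hκ, rfl⟩)
    · obtain ⟨u, hu, h1⟩ := hF.exists_joined e' h
      exact ⟨u, hu, h1.mono Set.subset_union_left⟩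
    · obtain ⟨u, hu, h1⟩ := hmove κ hκ m hm
      have h1' : T.Joined F' u (κ • m) := h1.mono Set.subset_union_left
      rcases hym with ⟨h3, h2⟩ | ⟨h3, h2⟩
      · refine ⟨u, hu, ?_⟩
        rw [h2, ← T.tgt_smul] at h1'
        exact h1'.trans (joined_edge (Or.inr ⟨κ, hκ, rfl⟩)).symm
      · rw [h2, ← T.src_smul] at h1'
        exact ⟨u, hu, h1'⟩

theorem exists_isMarkedForest (T : EquivariantTree G V ι) (hA : ∀ κ ∈ K, ∀ e ∈ A, κ • e ∈ A)
    (hU : ∀ κ ∈ K, ∀ u ∈ U, κ • u ∈ U) (hstab : ∀ x ∉ U, ∀ κ ∈ K, κ • x = x → κ = 1) :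
    ∃ F, T.IsMarkedForest K A U F ∧
      ∀ x, (∃ u ∈ U, T.Joined A u x) → ∃ u ∈ U, T.Joined F u x := by
  classical
  obtain ⟨F, hF⟩ : ∃ F, Maximal (T.IsMarkedForest K A U) F := by
    refine zorn_subset {F | T.IsMarkedForest K A U F} fun C hC hchain => ?_
    rcases C.eq_empty_or_nonempty with rfl | hne
    · refine ⟨∅, ⟨by simp, by simp, ?_, by simp⟩, by simp⟩
      intro u _ v _ h
      apply T.eq_of_c_eq_zero
      ext e
      exact c_apply_eq_zero_of_joined h (by simp)
    · refine ⟨⋃₀ C, ⟨?_, ?_, ?_, ?_⟩, fun F hF => Set.subset_sUnion_of_mem hF⟩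
      · exact Set.sUnion_subset fun F hF => (hC hF).subset
      · rintro κ hκ e ⟨F, hF, he⟩
        exact ⟨F, hF, (hC hF).smul_mem κ hκ e he⟩
      · intro u hu v hv h
        have hsub : ((T.c u v).support : Set (Edge G ι)) ⊆ ⋃₀ C := by
          intro e he
          exact h e (by simpa using he)
        obtain ⟨F, hF, hF'⟩ := DirectedOn.exists_mem_subset_of_finite_of_subset_sUnion
          hne hchain.directedOn (T.c u v).support.finite_toSet hsub
        exact (hC hF).eq_of_joined u hu v hv fun e he => hF' (by simpa using he)
      · rintro e ⟨F, hF, he⟩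
        obtain ⟨u, hu, h⟩ := (hC hF).exists_joined e he
        exact ⟨u, hu, h.mono (Set.subset_sUnion_of_mem hF)⟩
  refine ⟨F, hF.1, ?_⟩
  rintro x ⟨u₀, hu₀, hx⟩
  by_contra hcon
  have h1 : ∃ e, T.c u₀ x e ≠ 0 ∧ ¬ ((∃ u ∈ U, T.Joined F u (T.src e)) =
      ∃ u ∈ U, T.Joined F u (T.tgt e)) := by
    by_contra! h
    have := T.eq_of_forall_edge (fun z => ∃ u ∈ U, T.Joined F u z) h
    exact hcon (this.mp ⟨u₀, hu₀, Joined.refl F u₀⟩)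
  obtain ⟨e, he, hne⟩ := h1
  have heA : e ∈ A := hx e he
  have hins : T.IsMarkedForest K A U (F ∪ {e' | ∃ κ ∈ K, e' = κ • e}) := by
    by_cases hs : ∃ u ∈ U, T.Joined F u (T.src e)
    · refine hF.1.insert_orbit hA hU hstab heA (Or.inr ⟨rfl, rfl⟩) hs fun ht => hne ?_
      simp only [hs, ht]
    · refine hF.1.insert_orbit hA hU hstab heA (Or.inl ⟨rfl, rfl⟩) ?_ hs
      by_contra ht
      apply hne
      simp only [hs, ht]
  have heF : e ∈ F := hF.2 hins Set.subset_union_left (Or.inr ⟨1, one_mem K, (one_smul _ _).symm⟩)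
  apply hne
  obtain ⟨u, hu, h⟩ := hF.1.exists_joined e heF
  exact propext ⟨fun _ => ⟨u, hu, h.trans (joined_edge heF)⟩, fun _ => ⟨u, hu, h⟩⟩

end EquivariantTree

theorem mem_fixedSubgroup {G : Type*} [Group G] {φ : G →* G} {g : G} :
    g ∈ fixedSubgroup φ ↔ φ g = g := Iff.rfl

/-- The iterates of an endomorphism. -/
def MonoidHom.iter {G : Type*} [Group G] (φ : G →* G) (m : ℕ) : G →* G where
  toFun := φ^[m]
  map_one' := iterate_map_one φ m
  map_mul' := iterate_map_mul φ m

theorem MonoidHom.iter_apply {G : Type*} [Group G] (φ : G →* G) (m : ℕ) (g : G) :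
    φ.iter m g = φ^[m] g := rfl

theorem MonoidHom.iter_mul {G : Type*} [Group G] (φ : G →* G) (m n : ℕ) :
    φ.iter (m * n) = (φ.iter m).iter n := by
  ext g
  rw [iter_apply, iter_apply, Function.iterate_mul]
  rfl

namespace EquivariantTree

/-- Edge chains as finitely supported functions on pairs. -/
noncomputable def edgeChain {G ι : Type*} : (Edge G ι →₀ ℤ) →+ (G × ι →₀ ℝ) where
  toFun a := (a.mapRange (Int.castAddHom ℝ) (map_zero _)).equivMapDomain
    ⟨fun e => (e.1, e.2), fun e => ⟨e.1, e.2⟩, fun _ => rfl, fun _ => rfl⟩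
  map_zero' := by ext; simp
  map_add' a b := by ext; simp

theorem edgeChain_apply {G ι : Type*} (a : Edge G ι →₀ ℤ) (x : G × ι) :
    edgeChain a x = a ⟨x.1, x.2⟩ := rfl

theorem edgeChain_single {G ι : Type*} (e : Edge G ι) (n : ℤ) :
    edgeChain (Finsupp.single e n) = Finsupp.single (e.1, e.2) (n : ℝ) := by
  classical
  ext x
  rw [edgeChain_apply, Finsupp.single_apply, Finsupp.single_apply]
  have : e = ⟨x.1, x.2⟩ ↔ (e.1, e.2) = x := by
    rw [Edge.ext_iff, Prod.ext_iff]
  simp only [this]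
  split_ifs <;> simp

variable {G V ι : Type*} [Group G] [MulAction G V] (T : EquivariantTree G V ι)

/-- A self-map of the vertex set, equivariant along an injective endomorphism. -/
structure IsTwist (φ : G →* G) (f : V → V) : Prop where
  inj : Function.Injective φ
  map_smul : ∀ (g : G) x, f (g • x) = φ g • f x
  map_o : f T.o = T.o

variable {T} {φ : G →* G} {f : V → V}

theorem IsTwist.iterate_smul (h : T.IsTwist φ f) (m : ℕ) (g : G) (x : V) :
    f^[m] (g • x) = φ^[m] g • f^[m] x := by
  induction m with
  | zero => rfl
  | succ m ih => rw [Function.iterate_succ_apply', Function.iterate_succ_apply',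
      Function.iterate_succ_apply', ih, h.map_smul]

theorem IsTwist.iterate (h : T.IsTwist φ f) (m : ℕ) : T.IsTwist (φ.iter m) f^[m] where
  inj := h.inj.iterate m
  map_smul := h.iterate_smul m
  map_o := Function.iterate_fixed h.map_o m

/-- Geodesics are mapped to the concatenation of the images of their edges. -/
theorem IsTwist.c_map (h : T.IsTwist φ f) (x y : V) :
    T.c (f x) (f y) = (T.c x y).sum fun e n =>
      n • (T.c T.o (f (T.w e.2))).mapDomain fun e' => φ e.1 • e' := by
  have h1 := T.sub_eq_sum (fun z => T.c T.o (f z)) x y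
  have h2 : ∀ x y : V, T.c T.o y - T.c T.o x = T.c x y := by
    intro x y
    rw [sub_eq_iff_eq_add', T.c_add]
  simp only [h2] at h1
  rw [h1]
  refine Finsupp.sum_congr fun e _ => ?_
  congr 1
  unfold tgt src
  rw [h.map_smul, h.map_smul, h.map_o]
  ext e'
  rw [T.c_smul_apply]
  conv_rhs => rw [← smul_inv_smul (φ e.1) e']
  exact (Finsupp.mapDomain_apply (MulAction.injective (φ e.1)) _ _).symm

theorem edgeChain_mapDomain (a : Edge G ι →₀ ℤ) (g : G) :
    edgeChain (a.mapDomain fun e => g • e) =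
      (edgeChain a).mapDomain fun x => (g * x.1, x.2) := by
  induction a using Finsupp.induction_linear with
  | zero => simp
  | add a b ha hb => simp [Finsupp.mapDomain_add, ha, hb]
  | single e n =>
    rw [Finsupp.mapDomain_single, edgeChain_single, edgeChain_single, Finsupp.mapDomain_single]
    rfl

theorem edgeChain_sum (a : Edge G ι →₀ ℤ) (d : ι → Edge G ι →₀ ℤ) (ψ : G → G) :
    edgeChain (a.sum fun e n => n • (d e.2).mapDomain fun e' => ψ e.1 • e') =
      (edgeChain a).sum fun x r =>
        r • (edgeChain (d x.2)).mapDomain fun x' => (ψ x.1 * x'.1, x'.2) := by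
  classical
  induction a using Finsupp.induction_linear with
  | zero => simp
  | add a b ha hb =>
    rw [Finsupp.sum_add_index' (by simp) (by intros; rw [add_smul]), map_add, map_add, ha, hb,
      Finsupp.sum_add_index' (by simp) (by intros; rw [add_smul])]
  | single e n =>
    rw [Finsupp.sum_single_index (by simp), edgeChain_single,
      Finsupp.sum_single_index (by simp), map_zsmul, edgeChain_mapDomain, Int.cast_smul_eq_zsmul]

open Classical in
theorem IsTwist.card_le_of_periodic [Fintype ι] (h : T.IsTwist φ f) {k : ℕ} (u v : Fin k → V)
    (hu : ∀ j, f (u j) = u j) (hv : ∀ j, f (v j) = v j) (ε : Fin k → Edge G ι)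
    (hpriv : ∀ g, (∃ m, 0 < m ∧ φ^[m] g = g) → ∀ i j,
      T.c (u j) (v j) (g • ε i) = if i = j ∧ g = 1 then 1 else 0) : k ≤ Fintype.card ι := by
  classical
  rw [← Fintype.card_fin k]
  refine EllTwo.card_le_of_private φ h.inj (fun j => edgeChain (T.c (u j) (v j)))
    (fun i => edgeChain (T.c T.o (f (T.w i)))) (fun j => ?_) (fun i => ((ε i).1, (ε i).2)) ?_
  · have h1 := h.c_map (u j) (v j)
    rw [hu, hv] at h1
    conv_lhs => rw [h1]
    exact edgeChain_sum _ (fun i => T.c T.o (f (T.w i))) φ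
  · intro g hg i j
    rw [edgeChain_apply]
    have := hpriv g hg i j
    change T.c (u j) (v j) ⟨g * (ε i).1, (ε i).2⟩ = _ at this
    rw [this]
    split_ifs <;> simp

end EquivariantTree

namespace EquivariantTree

variable {G V ι : Type*} [Group G] [MulAction G V] {T : EquivariantTree G V ι}
  {K : Subgroup G} {A : Set (Edge G ι)} {U : Set V} {F : Set (Edge G ι)}

variable (T K A U) in
open Classical in
/-- There are `k` geodesics with edges in `A` between vertices of `U`, each of which crosses an
edge whose `K`-orbit meets the geodesics of the family nowhere else. -/
def HasFamily (k : ℕ) : Prop :=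
  ∃ (u v : Fin k → V) (ε : Fin k → Edge G ι),
    (∀ j, u j ∈ U ∧ v j ∈ U ∧ T.Joined A (u j) (v j)) ∧
    ∀ κ ∈ K, ∀ i j, T.c (u j) (v j) (κ • ε i) = if i = j ∧ κ = 1 then 1 else 0

theorem IsMarkedForest.hasFamily (hF : T.IsMarkedForest K A U F)
    (hcov : ∀ x, (∃ u ∈ U, T.Joined A u x) → ∃ u ∈ U, T.Joined F u x)
    {k : ℕ} (ε : Fin k → Edge G ι) (hA : ∀ i, ε i ∈ A) (hεF : ∀ i, ε i ∉ F)
    (hsrc : ∀ i, ∃ u ∈ U, T.Joined A u (T.src (ε i)))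
    (horb : ∀ κ ∈ K, ∀ i j, κ • ε i = ε j → i = j) : T.HasFamily K A U k := by
  classical
  have htgt : ∀ i, ∃ u ∈ U, T.Joined A u (T.tgt (ε i)) := fun i =>
    let ⟨u, hu, h⟩ := hsrc i
    ⟨u, hu, h.trans (joined_edge (hA i))⟩
  choose u hu hus using fun i => hcov _ (hsrc i)
  choose v hv hvt using fun i => hcov _ (htgt i)
  refine ⟨u, v, ε, fun j => ⟨hu j, hv j, ?_⟩, fun κ hκ i j => ?_⟩
  · exact (((hus j).mono hF.subset).trans (joined_edge (hA j))).trans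
      ((hvt j).mono hF.subset).symm
  · have hnot : κ • ε i ∉ F := fun h => hεF i (by
      simpa using hF.smul_mem κ⁻¹ (inv_mem hκ) _ h)
    rw [← T.c_add (u j) (T.src (ε j)), ← T.c_add (T.src (ε j)) (T.tgt (ε j)), T.c_edge,
      Finsupp.add_apply, Finsupp.add_apply, c_apply_eq_zero_of_joined (hus j) hnot,
      c_apply_eq_zero_of_joined (hvt j).symm hnot, zero_add, add_zero, Finsupp.single_apply]
    congr 1
    rw [eq_iff_iff]
    constructor
    · intro h
      obtain rfl := horb κ hκ i j h.symm
      exact ⟨rfl, Edge.smul_eq_self_iff.1 h.symm⟩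
    · rintro ⟨rfl, rfl⟩
      rw [one_smul]

theorem IsMarkedForest.unique (hF : T.IsMarkedForest K A U F) {x y u v : V} (hu : u ∈ U)
    (hv : v ∈ U) (hux : T.Joined F u x) (hvy : T.Joined F v y) (hxy : T.Joined F x y) : u = v :=
  hF.eq_of_joined u hu v hv ((hux.trans hxy).trans hvy.symm)

theorem exists_marking (T : EquivariantTree G V ι) (hA : ∀ κ ∈ K, ∀ e ∈ A, κ • e ∈ A)
    (hU : ∀ κ ∈ K, ∀ u ∈ U, κ • u ∈ U) (hF : T.IsMarkedForest K A U F)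
    (hcov : ∀ x, (∃ u ∈ U, T.Joined A u x) → ∃ u ∈ U, T.Joined F u x) (ho : T.o ∈ U) :
    ∃ μ : V → V, (∀ x, μ x ∈ U) ∧ (∀ u ∈ U, μ u = u) ∧
      (∀ e ∈ F, μ (T.src e) = μ (T.tgt e)) ∧
      (∀ e ∈ A, (¬ ∃ u ∈ U, T.Joined A u (T.src e)) → μ (T.src e) = μ (T.tgt e)) ∧
      ∀ κ ∈ K, ∀ x, (∃ u ∈ U, T.Joined A u x) → μ (κ • x) = κ • μ x := by
  classical
  have hex : ∀ x, ∃ m ∈ U, ((∃ u ∈ U, T.Joined A u x) → T.Joined F m x) ∧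
      ((¬ ∃ u ∈ U, T.Joined A u x) → m = T.o) := by
    intro x
    by_cases hx : ∃ u ∈ U, T.Joined A u x
    · obtain ⟨u, hu, h⟩ := hcov x hx
      exact ⟨u, hu, fun _ => h, fun h' => (h' hx).elim⟩
    · exact ⟨T.o, ho, fun h => (hx h).elim, fun _ => rfl⟩
  choose μ hμU hμF hμo using hex
  refine ⟨μ, hμU, fun u hu => ?_, fun e he => ?_, fun e he h => ?_, fun κ hκ x hx => ?_⟩
  · exact hF.eq_of_joined _ (hμU u) u hu (hμF u ⟨u, hu, .refl _ _⟩)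
  · obtain ⟨u, hu, h⟩ := hF.exists_joined e he
    exact hF.unique (hμU _) (hμU _) (hμF _ ⟨u, hu, h.mono hF.subset⟩)
      (hμF _ ⟨u, hu, (h.trans (joined_edge he)).mono hF.subset⟩) (joined_edge he)
  · rw [hμo _ h, hμo _ fun ⟨u, hu, h'⟩ => h ⟨u, hu, h'.trans (joined_edge he).symm⟩]
  · obtain ⟨u, hu, h⟩ := hx
    exact hF.unique (hμU _) (hU κ hκ _ (hμU _)) (hμF _ ⟨κ • u, hU κ hκ u hu, h.smul (hA κ hκ)⟩)
      ((hμF x ⟨u, hu, h⟩).smul (hF.smul_mem κ hκ)) (.refl _ _)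

theorem hasFamily_of_cocycle {k : Type*} [Field k] (T : EquivariantTree G V ι)
    (hA : ∀ κ ∈ K, ∀ e ∈ A, κ • e ∈ A)
    (hU : ∀ κ ∈ K, ∀ u ∈ U, κ • u ∈ U) (hstab : ∀ x ∉ U, ∀ κ ∈ K, κ • x = x → κ = 1)
    (ho : T.o ∈ U) {n : ℕ} (u v : Fin n → V)
    (huv : ∀ j, u j ∈ U ∧ v j ∈ U ∧ T.Joined A (u j) (v j)) (b : Fin n → V → V → k)
    (hadd : ∀ i, ∀ x ∈ U, ∀ y ∈ U, ∀ z ∈ U, b i x y + b i y z = b i x z)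
    (hinv : ∀ κ ∈ K, ∀ i, ∀ x ∈ U, ∀ y ∈ U, b i (κ • x) (κ • y) = b i x y)
    (hb : ∀ i j, b i (u j) (v j) = if i = j then 1 else 0) : T.HasFamily K A U n := by
  classical
  obtain ⟨F, hF, hcov⟩ := exists_isMarkedForest T hA hU hstab
  obtain ⟨μ, hμU, hμu, hμF, hμA, hμK⟩ := exists_marking T hA hU hF hcov ho
  let col : Edge G ι → Fin n → k := fun e i => b i (μ (T.src e)) (μ (T.tgt e))
  have hself : ∀ i, ∀ x ∈ U, b i x x = 0 := fun i x hx => by simpa using hadd i x hx x hx x hx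
  let S : Set (Fin n → k) := col '' {e | e ∈ A ∧ e ∉ F ∧ ∃ u ∈ U, T.Joined A u (T.src e)}
  have hcol : ∀ e ∈ A, col e ∈ Submodule.span k S := by
    intro e he
    by_cases h1 : μ (T.src e) = μ (T.tgt e)
    · have : col e = 0 := by
        ext i
        change b i _ _ = 0
        rw [h1, hself i _ (hμU _)]
      rw [this]
      exact zero_mem _
    · refine Submodule.subset_span ⟨e, ⟨he, fun h => h1 (hμF e h), ?_⟩, rfl⟩
      by_contra h
      exact h1 (hμA e he h)
  have hspan : ⊤ ≤ Submodule.span k S := by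
    rw [← (Pi.basisFun k (Fin n)).span_eq, Submodule.span_le]
    rintro _ ⟨j, rfl⟩
    have h1 : Pi.basisFun k (Fin n) j =
        (T.c (u j) (v j)).sum fun e m => m • col e := by
      have h2 := T.sub_eq_sum (fun x i => b i T.o (μ x)) (u j) (v j)
      have h3 : ∀ x y, (fun i => b i T.o (μ y)) - (fun i => b i T.o (μ x)) =
          fun i => b i (μ x) (μ y) := by
        intro x y
        ext i
        rw [Pi.sub_apply, sub_eq_iff_eq_add', hadd i _ ho _ (hμU x) _ (hμU y)]
      simp only [h3] at h2
      rw [← h2]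
      ext i
      rw [hμu _ (huv j).1, hμu _ (huv j).2.1, hb, Pi.basisFun_apply, Pi.single_apply]
    rw [h1]
    refine Submodule.sum_mem _ fun e he => zsmul_mem (hcol e ?_) _
    exact (huv j).2.2 e (by simpa using he)
  obtain ⟨B, hBS, hBspan, hBind⟩ := exists_linearIndependent k S
  let bas : Module.Basis B k (Fin n → k) := Module.Basis.mk hBind (by
    rw [Subtype.range_coe, hBspan]; exact hspan)
  let σ : Fin n ≃ B := (Pi.basisFun k (Fin n)).indexEquiv bas
  choose ε hε using fun i => hBS (σ i).2
  refine hF.hasFamily hcov ε (fun i => (hε i).1.1) (fun i => (hε i).1.2.1)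
    (fun i => (hε i).1.2.2) fun κ hκ i j hij => ?_
  apply σ.injective
  apply Subtype.ext
  rw [← (hε i).2, ← (hε j).2, ← hij]
  ext l
  obtain ⟨w, hw, h⟩ := (hε i).1.2.2
  change b l _ _ = b l _ _
  rw [T.src_smul, T.tgt_smul, hμK κ hκ _ ⟨w, hw, h⟩,
    hμK κ hκ _ ⟨w, hw, h.trans (joined_edge (hε i).1.1)⟩, hinv κ hκ l _ (hμU _) _ (hμU _)]

end EquivariantTree

theorem Finset.sum_range_shift {M : Type*} [AddCommGroup M] (F : ℕ → M) {p : ℕ} (h : F p = F 0) :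
    ∑ i ∈ Finset.range p, F (i + 1) = ∑ i ∈ Finset.range p, F i := by
  have h1 := Finset.sum_range_succ F p
  rw [Finset.sum_range_succ', h] at h1
  exact add_right_cancel h1

theorem Finsupp.degree_eq_of_mul {H R : Type*} [Group H] [AddCommMonoid R] {a b : H →₀ R} (h : H)
    (hab : ∀ s, a (h * s) = b s) : a.degree = b.degree := by
  have : a = b.mapDomain (h * ·) := by
    ext s
    rw [← mul_inv_cancel_left h s, hab]
    exact (Finsupp.mapDomain_apply (mul_right_injective h) _ _).symm
  rw [this, Finsupp.degree_mapDomain]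

theorem Finsupp.dvd_degree {H : Type*} [Group H] {p : ℕ} [hp : Fact p.Prime] {h : H}
    (h1 : h ≠ 1) (hhp : h ^ p = 1) (a : H →₀ ℤ) (ha : ∀ s, a (h * s) = a s) :
    (p : ℤ) ∣ a.degree := by
  classical
  rw [← ZMod.intCast_zmod_eq_zero_iff_dvd, Finsupp.degree_apply, Int.cast_sum,
    Finset.sum_eq_sum_fixed p (fun s => h * s) (fun s => by
      rw [mul_left_iterate, hhp]; exact one_mul s) _ (by
      intro s hs
      simpa [ha] using hs) _ (by intro s; rw [ha])]
  refine Finset.sum_eq_zero fun s hs => ?_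
  exact (h1 (by simpa using (Finset.mem_filter.1 hs).2)).elim

namespace EquivariantTree

variable {G V ι : Type*} [Group G] [MulAction G V] (T : EquivariantTree G V ι)

/-- The part of a geodesic lying in the orbit of an edge. -/
noncomputable def orbitPart (H : Subgroup G) (ε : Edge G ι) (x y : V) : H →₀ ℤ :=
  (T.c x y).comapDomain (fun s : H => (s : G) • ε) fun _ _ _ _ h =>
    Subtype.ext (Edge.smul_right_injective ε h)

variable {T} {H : Subgroup G} {ε : Edge G ι}

theorem orbitPart_apply (x y : V) (s : H) :
    T.orbitPart H ε x y s = T.c x y ((s : G) • ε) := rfl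

theorem orbitPart_add (x y z : V) :
    T.orbitPart H ε x y + T.orbitPart H ε y z = T.orbitPart H ε x z := by
  ext s
  rw [Finsupp.add_apply, orbitPart_apply, orbitPart_apply, orbitPart_apply, ← T.c_add x y z]
  rfl

theorem orbitPart_self (x : V) : T.orbitPart H ε x x = 0 := by
  simpa using T.orbitPart_add (H := H) (ε := ε) x x x

theorem orbitPart_smul (h : H) (x y : V) (s : H) :
    T.orbitPart H ε ((h : G) • x) ((h : G) • y) (h * s) = T.orbitPart H ε x y s := by
  rw [orbitPart_apply, orbitPart_apply, Subgroup.coe_mul, mul_smul, T.c_smul]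

variable (T H ε) in
/-- The signed number of crossings of an edge orbit. -/
noncomputable def weight (x y : V) : ℤ := (T.orbitPart H ε x y).degree

theorem weight_add (x y z : V) : T.weight H ε x y + T.weight H ε y z = T.weight H ε x z := by
  unfold weight
  rw [← map_add, orbitPart_add]

theorem weight_smul (h : H) (x y : V) :
    T.weight H ε ((h : G) • x) ((h : G) • y) = T.weight H ε x y :=
  Finsupp.degree_eq_of_mul h (orbitPart_smul h x y)

variable (T H ε) in
/-- The translation homomorphism counting crossings of an edge orbit. -/
noncomputable def translation : H →* Multiplicative ℤ where
  toFun h := Multiplicative.ofAdd (T.weight H ε T.o ((h : G) • T.o))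
  map_one' := by simp [weight, orbitPart_self]
  map_mul' a b := by
    rw [← ofAdd_add, Subgroup.coe_mul, mul_smul, ← weight_add T.o ((a : G) • T.o),
      weight_smul]

variable (T H ε) in
/-- The sum of the crossings from a vertex to its iterates. -/
noncomputable def defect (f : V → V) (p : ℕ) (x : V) : H →₀ ℤ :=
  ∑ i ∈ Finset.range p, T.orbitPart H ε x (f^[i] x)

variable (T H ε) in
/-- The total least residue of the negated defect. -/
noncomputable def residue (f : V → V) (p : ℕ) (x : V) : H →₀ ℤ :=
  (T.defect H ε f p x).mapRange (fun n => (((-n : ℤ) : ZMod p).val : ℤ)) (by simp)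

variable (T H ε) in
/-- The sum of the crossings from the base vertex to the iterates of a vertex. -/
noncomputable def height (f : V → V) (p : ℕ) (x : V) : ℤ :=
  ∑ i ∈ Finset.range p, T.weight H ε T.o (f^[i] x)

variable (T H ε) in
/-- The averaged height of a vertex, corrected to an integer. -/
noncomputable def potential (f : V → V) (p : ℕ) (x : V) : ℤ :=
  T.height H ε f p x / p + (T.residue H ε f p x).degree / p

section

variable {φ : G →* G} {f : V → V} {p : ℕ} {x y : V}

theorem residue_apply (s : H) : T.residue H ε f p x s =
    (((-(T.defect H ε f p x s) : ℤ) : ZMod p).val : ℤ) := rfl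

theorem residue_intCast [NeZero p] (s : H) :
    ((T.residue H ε f p x s : ℤ) : ZMod p) = ((-(T.defect H ε f p x s) : ℤ) : ZMod p) := by
  rw [residue_apply, Int.cast_natCast, ZMod.natCast_zmod_val]

theorem residue_congr (s t : H)
    (h : ((T.defect H ε f p x s : ℤ) : ZMod p) = (T.defect H ε f p y t : ℤ)) :
    T.residue H ε f p x s = T.residue H ε f p y t := by
  rw [residue_apply, residue_apply, Int.cast_neg, Int.cast_neg, h]

theorem defect_apply_map (hx : f^[p] x = x) (s : H) :
    T.defect H ε f p (f x) s = p * T.orbitPart H ε (f x) x s + T.defect H ε f p x s := by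
  have h1 : T.defect H ε f p (f x) = p • T.orbitPart H ε (f x) x + T.defect H ε f p x := by
    unfold defect
    rw [← Finset.sum_range_shift (fun i => T.orbitPart H ε x (f^[i] x)) (by simp [hx])]
    simp only [← Function.iterate_succ_apply]
    rw [← Finset.card_range p, ← Finset.sum_const, Finset.card_range, ← Finset.sum_add_distrib]
    refine Finset.sum_congr rfl fun i _ => ?_
    rw [orbitPart_add]
  rw [h1, Finsupp.add_apply, Finsupp.smul_apply, nsmul_eq_mul]

theorem potential_map (hx : f^[p] x = x) :
    T.potential H ε f p (f x) = T.potential H ε f p x := by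
  unfold potential
  congr 2
  · unfold height
    rw [← Finset.sum_range_shift (fun i => T.weight H ε T.o (f^[i] x)) (by simp [hx])]
    rfl
  · congr 1
    ext s
    refine residue_congr _ _ ?_
    rw [defect_apply_map hx]
    simp

theorem iterate_smul_of_map_smul (hf : ∀ (h : H) x, f ((h : G) • x) = (h : G) • f x) (h : H)
    (x : V) (i : ℕ) : f^[i] ((h : G) • x) = (h : G) • f^[i] x := by
  induction i with
  | zero => rfl
  | succ i ih => rw [Function.iterate_succ_apply', Function.iterate_succ_apply', ih, hf]

theorem defect_smul (hf : ∀ (h : H) x, f ((h : G) • x) = (h : G) • f x) (h s : H) :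
    T.defect H ε f p ((h : G) • x) (h * s) = T.defect H ε f p x s := by
  unfold defect
  simp only [Finsupp.finsetSum_apply, iterate_smul_of_map_smul hf, orbitPart_smul]

theorem potential_smul [hp : NeZero p] (hf : ∀ (h : H) x, f ((h : G) • x) = (h : G) • f x) (h : H) :
    T.potential H ε f p ((h : G) • x) =
      T.potential H ε f p x + T.weight H ε T.o ((h : G) • T.o) := by
  have h1 : T.height H ε f p ((h : G) • x) =
      T.height H ε f p x + T.weight H ε T.o ((h : G) • T.o) * p := by
    unfold height
    rw [mul_comm, ← nsmul_eq_mul]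
    conv_rhs => rw [← Finset.card_range p, ← Finset.sum_const, Finset.card_range,
      ← Finset.sum_add_distrib]
    refine Finset.sum_congr rfl fun i _ => ?_
    rw [iterate_smul_of_map_smul hf, ← weight_add T.o ((h : G) • T.o), weight_smul, add_comm]
  have h2 : (T.residue H ε f p ((h : G) • x)).degree = (T.residue H ε f p x).degree :=
    Finsupp.degree_eq_of_mul h fun s => residue_congr _ _ (by rw [defect_smul hf])
  unfold potential
  rw [h1, h2, Int.add_mul_ediv_right _ _ (by exact_mod_cast hp.out)]
  ring

theorem potential_congr
    (h : ∀ i < p, T.orbitPart H ε (f^[i] x) (f^[i] y) = 0) (hp : 0 < p) :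
    T.potential H ε f p x = T.potential H ε f p y := by
  unfold potential
  congr 2
  · unfold height
    refine Finset.sum_congr rfl fun i hi => ?_
    rw [← weight_add T.o (f^[i] x) (f^[i] y), weight, weight, h i (Finset.mem_range.1 hi)]
    simp
  · congr 1
    ext s
    refine residue_congr _ _ ?_
    congr 2
    unfold defect
    refine Finset.sum_congr rfl fun i hi => ?_
    have h0 := h 0 hp
    rw [Function.iterate_zero_apply, Function.iterate_zero_apply] at h0
    have h1 := T.orbitPart_add (H := H) (ε := ε) x y (f^[i] y)
    rw [h0, zero_add, ← orbitPart_add x (f^[i] x), h i (Finset.mem_range.1 hi), add_zero] at h1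
    exact h1.symm

theorem potential_of_fixed [hp : NeZero p] (hx : f x = x) :
    T.potential H ε f p x = T.weight H ε T.o x := by
  have hfi : ∀ i, f^[i] x = x := Function.iterate_fixed hx
  have h1 : T.defect H ε f p x = 0 := by
    unfold defect
    refine Finset.sum_eq_zero fun i _ => ?_
    rw [hfi, orbitPart_self]
  have h2 : T.residue H ε f p x = 0 := by
    ext s
    rw [residue_apply, h1]
    simp
  unfold potential height
  simp only [hfi]
  rw [h2, Finset.sum_const, Finset.card_range, nsmul_eq_mul, map_zero, Int.zero_ediv, add_zero,
    mul_comm, Int.mul_ediv_cancel _ (by exact_mod_cast hp.out)]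

theorem weight_smul_eq_zero (hp : p ≠ 0) {h : H} (hhp : h ^ p = 1) :
    T.weight H ε T.o ((h : G) • T.o) = 0 := by
  have h1 : T.translation H ε h ^ p = 1 := by rw [← map_pow, hhp, map_one]
  have h2 : p • T.weight H ε T.o ((h : G) • T.o) = 0 := congrArg Multiplicative.toAdd h1
  simpa [hp] using h2

theorem iterate_of_smul_map (hf : ∀ (h : H) x, f ((h : G) • x) = (h : G) • f x) {h : H}
    (hx : (h : G) • f x = x) (i : ℕ) : f^[i] x = ((h⁻¹ ^ i : H) : G) • x := by
  induction i with
  | zero => simp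
  | succ i ih =>
    have hfx : f x = ((h⁻¹ : H) : G) • x := by
      rw [Subgroup.coe_inv, eq_inv_smul_iff, hx]
    rw [Function.iterate_succ_apply', ih, hf, hfx, smul_smul, ← Subgroup.coe_mul, pow_succ]

theorem height_of_smul_map (hp : p ≠ 0) (hf : ∀ (h : H) x, f ((h : G) • x) = (h : G) • f x) {h : H}
    (hhp : h ^ p = 1) (hx : (h : G) • f x = x) :
    T.height H ε f p x = p * T.weight H ε T.o x := by
  unfold height
  rw [Finset.sum_congr rfl (g := fun _ => T.weight H ε T.o x), Finset.sum_const,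
    Finset.card_range, nsmul_eq_mul]
  intro i _
  rw [iterate_of_smul_map hf hx, ← weight_add T.o (((h⁻¹ ^ i : H) : G) • T.o), weight_smul,
    weight_smul_eq_zero hp, zero_add]
  rw [← pow_mul, mul_comm, pow_mul, inv_pow, hhp, inv_one, one_pow]

theorem residue_mul_of_smul_map (hf : ∀ (h : H) x, f ((h : G) • x) = (h : G) • f x) {h : H}
    (hx : (h : G) • f x = x) (hpx : f^[p] x = x) (s : H) :
    T.residue H ε f p x (h * s) = T.residue H ε f p x s := by
  have h1 : T.defect H ε f p x (h * s) = T.defect H ε f p (f x) s := by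
    conv_lhs => rw [← hx]
    exact defect_smul hf h s
  refine residue_congr _ _ ?_
  rw [h1, defect_apply_map hpx]
  simp

theorem potential_eq_of_smul_map [hp : Fact p.Prime]
    (hf : ∀ (h : H) x, f ((h : G) • x) = (h : G) • f x) {h : H} (h1 : h ≠ 1)
    (hhp : h ^ p = 1) (hx : (h : G) • f x = x) (hy : (h : G) • f y = y) (hpx : f^[p] x = x)
    (hpy : f^[p] y = y) :
    (T.potential H ε f p x : ZMod p) = T.potential H ε f p y := by
  have hp0 : p ≠ 0 := hp.out.ne_zero
  have hpz : (p : ℤ) ≠ 0 := by exact_mod_cast hp0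
  set N : H →₀ ℤ := ∑ i ∈ Finset.range p, T.orbitPart H ε (f^[i] x) (f^[i] y) with hN
  set D : H →₀ ℤ := T.residue H ε f p y - T.residue H ε f p x + N with hD
  have hNdeg : N.degree = p * T.weight H ε x y := by
    rw [hN, map_sum, Finset.sum_congr rfl (g := fun _ => T.weight H ε x y), Finset.sum_const,
      Finset.card_range, nsmul_eq_mul]
    intro i _
    rw [iterate_of_smul_map hf hx, iterate_of_smul_map hf hy]
    exact weight_smul _ _ _
  have hNinv : ∀ s, N (h * s) = N s := by
    intro s
    have hshift : ∀ z, (h : G) • f z = z → ∀ i, f^[i] z = (h : G) • f^[i + 1] z := by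
      intro z hz i
      rw [Function.iterate_succ_apply, ← iterate_smul_of_map_smul hf, hz]
    rw [← DFunLike.congr_fun (Finset.sum_range_shift
      (fun i => T.orbitPart H ε (f^[i] x) (f^[i] y)) (by simp [hpx, hpy])) s,
      hN, Finsupp.finsetSum_apply, Finsupp.finsetSum_apply]
    refine Finset.sum_congr rfl fun i _ => ?_
    rw [hshift x hx i, hshift y hy i, orbitPart_smul]
  have hDdvd : ∀ s, (p : ℤ) ∣ D s := by
    intro s
    rw [← ZMod.intCast_zmod_eq_zero_iff_dvd, hD, Finsupp.add_apply, Finsupp.sub_apply,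
      Int.cast_add, Int.cast_sub, residue_intCast, residue_intCast, ← Int.cast_sub,
      ← Int.cast_add, ZMod.intCast_zmod_eq_zero_iff_dvd]
    refine ⟨T.orbitPart H ε x y s, ?_⟩
    have h2 : T.defect H ε f p x + N = p • T.orbitPart H ε x y + T.defect H ε f p y := by
      unfold defect
      rw [hN, ← Finset.card_range p, ← Finset.sum_const, Finset.card_range,
        ← Finset.sum_add_distrib, ← Finset.sum_add_distrib]
      refine Finset.sum_congr rfl fun i _ => ?_
      rw [orbitPart_add, orbitPart_add]
    have h3 := DFunLike.congr_fun h2 s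
    rw [Finsupp.add_apply, Finsupp.add_apply, Finsupp.smul_apply, nsmul_eq_mul] at h3
    linarith
  set D' : H →₀ ℤ := D.mapRange (· / (p : ℤ)) (by simp) with hD'
  have hDD' : D = p • D' := by
    ext s
    rw [Finsupp.smul_apply, hD', Finsupp.mapRange_apply, nsmul_eq_mul,
      Int.mul_ediv_cancel' (hDdvd s)]
  have hD'inv : ∀ s, D' (h * s) = D' s := by
    intro s
    rw [hD', Finsupp.mapRange_apply, Finsupp.mapRange_apply, hD]
    simp only [Finsupp.add_apply, Finsupp.sub_apply, hNinv, residue_mul_of_smul_map hf hx hpx,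
      residue_mul_of_smul_map hf hy hpy]
  obtain ⟨t, ht⟩ := Finsupp.dvd_degree h1 hhp D' hD'inv
  obtain ⟨a, ha⟩ := Finsupp.dvd_degree h1 hhp (T.residue H ε f p x)
    (residue_mul_of_smul_map hf hx hpx)
  obtain ⟨b, hb⟩ := Finsupp.dvd_degree h1 hhp (T.residue H ε f p y)
    (residue_mul_of_smul_map hf hy hpy)
  have hsum : D.degree = p * b - p * a + p * T.weight H ε x y := by
    rw [hD, map_add, map_sub, hNdeg, ha, hb]
  rw [hDD', map_nsmul, ht, nsmul_eq_mul, ← mul_sub, ← mul_add] at hsum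
  have hsum' := mul_left_cancel₀ hpz hsum
  rw [ZMod.intCast_eq_intCast_iff_dvd_sub]
  unfold potential
  rw [height_of_smul_map hp0 hf hhp hx, height_of_smul_map hp0 hf hhp hy, ha, hb,
    Int.mul_ediv_cancel_left _ hpz, Int.mul_ediv_cancel_left _ hpz,
    Int.mul_ediv_cancel_left _ hpz, Int.mul_ediv_cancel_left _ hpz,
    ← weight_add T.o x y]
  exact ⟨t, by rw [hsum']; ring⟩

end

end EquivariantTree

namespace EquivariantTree

variable {G V ι : Type*} [Group G] [MulAction G V] {T : EquivariantTree G V ι}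
  {φ : G →* G} {f : V → V}

theorem IsTwist.map_fixed_smul (h : T.IsTwist φ f) (s : fixedSubgroup φ) (x : V) :
    f ((s : G) • x) = (s : G) • f x := by
  rw [h.map_smul, mem_fixedSubgroup.1 s.2]

theorem fixedSubgroup_le_iter (φ : G →* G) (p : ℕ) :
    fixedSubgroup φ ≤ fixedSubgroup (φ.iter p) := fun g hg => by
  rw [mem_fixedSubgroup, MonoidHom.iter_apply]
  exact Function.iterate_fixed (mem_fixedSubgroup.1 hg) p

variable (T φ f) in
/-- The variation of the potential between two vertices, seen from a coset of the fixed
subgroup. -/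
noncomputable def cosetTerm (h : T.IsTwist φ f) (p : ℕ) [Fact p.Prime] (ε : Edge G ι) (x y : V)
    (q : fixedSubgroup (φ.iter p) ⧸ (fixedSubgroup φ).subgroupOf (fixedSubgroup (φ.iter p))) :
    ZMod p :=
  Quotient.liftOn' q (fun g => (T.potential (fixedSubgroup φ) ε f p ((g : G)⁻¹ • y) : ZMod p) -
    T.potential (fixedSubgroup φ) ε f p ((g : G)⁻¹ • x)) fun a b hab => by
    rw [QuotientGroup.leftRel_apply] at hab
    have hs : ((a : G)⁻¹ * b) ∈ fixedSubgroup φ := by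
      simpa using Subgroup.mem_subgroupOf.1 hab
    have key : ∀ z : V, T.potential (fixedSubgroup φ) ε f p ((a : G)⁻¹ • z) =
        T.potential (fixedSubgroup φ) ε f p ((b : G)⁻¹ • z) +
          T.weight (fixedSubgroup φ) ε T.o (((a : G)⁻¹ * b) • T.o) := by
      intro z
      rw [← potential_smul (h.map_fixed_smul) ⟨_, hs⟩]
      simp [smul_smul]
    rw [key, key]
    push_cast
    ring

section

variable (h : T.IsTwist φ f) (p : ℕ) [hp : Fact p.Prime] (ε : Edge G ι)

theorem cosetTerm_mk (x y : V) (g : fixedSubgroup (φ.iter p)) :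
    T.cosetTerm φ f h p ε x y (QuotientGroup.mk g) =
    (T.potential (fixedSubgroup φ) ε f p ((g : G)⁻¹ • y) : ZMod p) -
    T.potential (fixedSubgroup φ) ε f p ((g : G)⁻¹ • x) := rfl

theorem cosetTerm_add (x y z : V) (q) : T.cosetTerm φ f h p ε x y q + T.cosetTerm φ f h p ε y z q =
    T.cosetTerm φ f h p ε x z q := by
  induction q using QuotientGroup.induction_on with
  | H g => simp only [cosetTerm_mk]; ring

theorem cosetTerm_smul (κ : fixedSubgroup (φ.iter p)) (x y : V) (q) :
    T.cosetTerm φ f h p ε ((κ : G) • x) ((κ : G) • y) (κ • q) = T.cosetTerm φ f h p ε x y q := by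
  induction q using QuotientGroup.induction_on with
  | H g =>
    change T.cosetTerm φ f h p ε _ _ (QuotientGroup.mk (κ * g)) = _
    simp only [cosetTerm_mk, Subgroup.coe_mul, mul_inv_rev, smul_smul, inv_mul_cancel_right]

theorem cosetTerm_finite (x y : V) : (Function.support (T.cosetTerm φ f h p ε x y)).Finite := by
  classical
  have hex : ∀ q ∈ Function.support (T.cosetTerm φ f h p ε x y), ∃ z : ℕ × Edge G ι,
      (z.1 < p ∧ T.c (f^[z.1] x) (f^[z.1] y) z.2 ≠ 0) ∧
      ∃ (g : fixedSubgroup (φ.iter p)) (s : fixedSubgroup φ), q = QuotientGroup.mk g ∧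
        φ.iter z.1 (g * s) • ε = z.2 := by
    intro q hq
    induction q using QuotientGroup.induction_on with
    | H g =>
      by_contra hcon
      apply hq
      rw [cosetTerm_mk, potential_congr _ hp.out.pos, sub_self]
      intro i hi
      ext s
      rw [orbitPart_apply, h.iterate_smul, h.iterate_smul, T.c_smul_apply, Finsupp.zero_apply]
      by_contra hne
      refine hcon ⟨(i, φ.iter i (g * s) • ε), ⟨hi, fun h0 => hne ?_⟩, g, s, rfl, rfl⟩
      have hs : φ.iter i s = s := by
        rw [MonoidHom.iter_apply]
        exact Function.iterate_fixed (mem_fixedSubgroup.1 s.2) i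
      have hg : (φ^[i] (g : G)⁻¹)⁻¹ = φ.iter i g := by
        rw [← MonoidHom.iter_apply, map_inv, inv_inv]
      change T.c (f^[i] x) (f^[i] y) _ = 0 at h0
      rw [map_mul, hs, mul_smul] at h0
      rw [hg, T.c_symm, Finsupp.neg_apply, h0, neg_zero]
  have : Nonempty (Edge G ι) := ⟨ε⟩
  choose! F hF hR using hex
  refine Set.Finite.of_injOn (f := F) (t := ⋃ i ∈ Finset.range p,
    (fun e => (i, e)) '' ((T.c (f^[i] x) (f^[i] y)).support : Set (Edge G ι))) ?_ ?_ ?_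
  · intro q hq
    simp only [Set.mem_iUnion, Finset.mem_range]
    exact ⟨(F q).1, (hF q hq).1, (F q).2, by simpa using (hF q hq).2, rfl⟩
  · intro q hq q' hq' hqq
    obtain ⟨g, s, rfl, h1⟩ := hR q hq
    obtain ⟨g', s', rfl, h2⟩ := hR q' hq'
    rw [← hqq, ← h1] at h2
    rw [hqq] at h2
    have h3 := (h.iterate _).inj (Edge.smul_right_injective ε h2)
    rw [QuotientGroup.eq, Subgroup.mem_subgroupOf]
    have h4 : ((g⁻¹ * g' : fixedSubgroup (φ.iter p)) : G) = s * (s' : G)⁻¹ := by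
      rw [Subgroup.coe_mul, Subgroup.coe_inv, eq_mul_inv_iff_mul_eq, mul_assoc, h3,
        inv_mul_cancel_left]
    rw [h4]
    exact mul_mem s.2 (inv_mem s'.2)
  · exact Set.Finite.biUnion (Finset.finite_toSet _) fun i _ => (Finset.finite_toSet _).image _

theorem map_mem_fixedSubgroup_iter (φ : G →* G) (p : ℕ) {g : G}
    (hg : g ∈ fixedSubgroup (φ.iter p)) :
    φ g ∈ fixedSubgroup (φ.iter p) := by
  rw [mem_fixedSubgroup, MonoidHom.iter_apply] at hg ⊢
  rw [← Function.iterate_succ_apply, Function.iterate_succ_apply', hg]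

/-- The action of the endomorphism on the cosets of its fixed subgroup. -/
def cosetMap (φ : G →* G) (p : ℕ) :
    fixedSubgroup (φ.iter p) ⧸ (fixedSubgroup φ).subgroupOf (fixedSubgroup (φ.iter p)) →
    fixedSubgroup (φ.iter p) ⧸ (fixedSubgroup φ).subgroupOf (fixedSubgroup (φ.iter p)) :=
  Quotient.map' (fun g => ⟨φ g, map_mem_fixedSubgroup_iter φ p g.2⟩) fun a b hab => by
    rw [QuotientGroup.leftRel_apply, Subgroup.mem_subgroupOf, Subgroup.coe_mul] at hab ⊢
    change φ ((a : G)⁻¹ * b) = (a : G)⁻¹ * b at hab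
    change φ ((φ a)⁻¹ * φ b) = (φ a)⁻¹ * φ b
    rw [← map_inv, ← map_mul, hab, hab]

theorem cosetMap_mk (φ : G →* G) (p : ℕ) (g : fixedSubgroup (φ.iter p)) :
    cosetMap φ p (QuotientGroup.mk g) =
      QuotientGroup.mk ⟨φ g, map_mem_fixedSubgroup_iter φ p g.2⟩ := rfl

theorem cosetMap_iterate_mk (φ : G →* G) (p i : ℕ) (g : fixedSubgroup (φ.iter p)) :
    ∃ g' : fixedSubgroup (φ.iter p), (g' : G) = φ^[i] g ∧
      (cosetMap φ p)^[i] (QuotientGroup.mk g) = QuotientGroup.mk g' := by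
  induction i with
  | zero => exact ⟨g, rfl, rfl⟩
  | succ i ih =>
    obtain ⟨g', h1, h2⟩ := ih
    refine ⟨⟨φ g', map_mem_fixedSubgroup_iter φ p g'.2⟩, ?_, ?_⟩
    · rw [Function.iterate_succ_apply', ← h1]
    · rw [Function.iterate_succ_apply', h2, cosetMap_mk]

theorem cosetMap_iterate (φ : G →* G) (p : ℕ) (q) : (cosetMap φ p)^[p] q = q := by
  induction q using QuotientGroup.induction_on with
  | H g =>
    obtain ⟨g', h1, h2⟩ := cosetMap_iterate_mk φ p p g
    rw [h2]
    congr 1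
    exact Subtype.ext (h1.trans g.2)

theorem iterate_smul_fixed (h : T.IsTwist φ f) {p : ℕ} (g : fixedSubgroup (φ.iter p)) {x : V}
    (hx : f^[p] x = x) : f^[p] ((g : G) • x) = (g : G) • x := by
  rw [h.iterate_smul, hx]
  congr 1
  exact g.2

theorem cosetTerm_cosetMap {x y : V} (hx : f x = x) (hy : f y = y) (q) :
    T.cosetTerm φ f h p ε x y (cosetMap φ p q) = T.cosetTerm φ f h p ε x y q := by
  induction q using QuotientGroup.induction_on with
  | H g =>
    have key : ∀ z, f z = z → T.potential (fixedSubgroup φ) ε f p ((φ g)⁻¹ • z) =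
        T.potential (fixedSubgroup φ) ε f p ((g : G)⁻¹ • z) := by
      intro z hz
      have hpz := iterate_smul_fixed h g⁻¹ (Function.iterate_fixed hz p)
      rw [Subgroup.coe_inv] at hpz
      rw [← potential_map hpz, h.map_smul, hz, map_inv]
    rw [cosetMap_mk, cosetTerm_mk, cosetTerm_mk]
    simp only [key x hx, key y hy]

theorem cosetTerm_eq_zero {x y : V} (hx : f x = x) (hy : f y = y) {q}
    (hq : cosetMap φ p q = q) (hq1 : q ≠ QuotientGroup.mk 1) :
    T.cosetTerm φ f h p ε x y q = 0 := by
  induction q using QuotientGroup.induction_on with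
  | H g =>
    rw [cosetMap_mk] at hq
    have hs : (g : G)⁻¹ * φ g ∈ fixedSubgroup φ := by
      simpa using Subgroup.mem_subgroupOf.1 (QuotientGroup.eq.1 hq.symm)
    have hfix : ∀ z, f z = z → ((⟨_, hs⟩ : fixedSubgroup φ) : G) • f ((g : G)⁻¹ • z) =
        (g : G)⁻¹ • z := by
      intro z hz
      rw [h.map_smul, hz, smul_smul, map_inv, mul_inv_cancel_right]
    have hpz : ∀ z, f z = z → f^[p] ((g : G)⁻¹ • z) = (g : G)⁻¹ • z := fun z hz =>
      iterate_smul_fixed h g⁻¹ (Function.iterate_fixed hz p)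
    have hiter : ∀ i : ℕ, φ^[i] (g : G) = g * ((g : G)⁻¹ * φ g) ^ i := by
      intro i
      induction i with
      | zero => simp
      | succ i ih =>
        rw [Function.iterate_succ_apply', ih, map_mul, map_pow, mem_fixedSubgroup.1 hs, pow_succ',
          ← mul_assoc, mul_inv_cancel_left]
    rw [cosetTerm_mk, sub_eq_zero]
    refine potential_eq_of_smul_map h.map_fixed_smul (h := ⟨_, hs⟩) ?_ ?_ (hfix y hy) (hfix x hx)
      (hpz y hy) (hpz x hx)
    · intro h1
      apply hq1
      rw [eq_comm, QuotientGroup.eq, Subgroup.mem_subgroupOf]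
      have h2 : (g : G)⁻¹ * φ g = 1 := congrArg Subtype.val h1
      rw [inv_mul_eq_one] at h2
      simpa [mem_fixedSubgroup] using h2.symm
    · apply Subtype.ext
      have h1 := hiter p
      rw [show φ^[p] (g : G) = g from g.2] at h1
      simpa using h1.symm

/-- The sum of the potential differences over all cosets, an extension to the vertices of
period `p` of the crossing cocycle mod `p` of the fixed vertices. -/
noncomputable def transfer (x y : V) : ZMod p := ∑ᶠ q, T.cosetTerm φ f h p ε x y q

theorem transfer_add (x y z : V) :
    T.transfer h p ε x y + T.transfer h p ε y z = T.transfer h p ε x z := by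
  unfold transfer
  rw [← finsum_add_distrib (cosetTerm_finite h p ε x y) (cosetTerm_finite h p ε y z)]
  exact finsum_congr fun q => cosetTerm_add h p ε x y z q

theorem transfer_smul (κ : fixedSubgroup (φ.iter p)) (x y : V) :
    T.transfer h p ε ((κ : G) • x) ((κ : G) • y) = T.transfer h p ε x y := by
  unfold transfer
  rw [← finsum_comp_equiv (MulAction.toPerm κ)]
  exact finsum_congr fun q => cosetTerm_smul h p ε κ x y q

theorem transfer_of_fixed {x y : V} (hx : f x = x) (hy : f y = y) :
    T.transfer h p ε x y = T.weight (fixedSubgroup φ) ε x y := by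
  classical
  unfold transfer
  have hσ := cosetTerm_cosetMap h p ε hx hy
  rw [finsum_eq_sum_of_support_subset (s := (cosetTerm_finite h p ε x y).toFinset) _ (by simp),
    Finset.sum_eq_sum_fixed p (cosetMap φ p) (cosetMap_iterate φ p) _ (by
      intro q hq
      rw [Set.Finite.mem_toFinset, Function.mem_support] at hq ⊢
      rwa [hσ]) _ hσ,
    Finset.sum_eq_single (QuotientGroup.mk 1)]
  · rw [cosetTerm_mk, Subgroup.coe_one, inv_one, one_smul, one_smul, potential_of_fixed hx,
      potential_of_fixed hy, ← weight_add T.o x y]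
    push_cast
    ring
  · intro q hq hq1
    exact cosetTerm_eq_zero h p ε hx hy (Finset.mem_filter.1 hq).2 hq1
  · intro hq
    by_contra hne
    apply hq
    simp only [Finset.mem_filter, Set.Finite.mem_toFinset, Function.mem_support]
    refine ⟨hne, ?_⟩
    rw [cosetMap_mk]
    congr 1
    exact Subtype.ext (map_one φ)

theorem HasFamily.prime_step (h : T.IsTwist φ f) (p : ℕ) [Fact p.Prime] {A A' : Set (Edge G ι)}
    {n : ℕ} (hfam : T.HasFamily (fixedSubgroup φ) A {x | f x = x} n) (hAA' : A ⊆ A')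
    (hA' : ∀ κ ∈ fixedSubgroup (φ.iter p), ∀ e ∈ A', κ • e ∈ A') :
    T.HasFamily (fixedSubgroup (φ.iter p)) A' {x | f^[p] x = x} n := by
  classical
  obtain ⟨u, v, ε, huv, hε⟩ := hfam
  refine hasFamily_of_cocycle (k := ZMod p) (U := {x | f^[p] x = x}) T hA' (fun κ hκ x hx => ?_)
    (fun x hx κ hκ hκx => ?_)
    (h.iterate p).map_o u v (fun j => ?_) (fun i => T.transfer h p (ε i)) ?_ ?_ ?_
  · exact iterate_smul_fixed h ⟨κ, hκ⟩ hx
  · by_contra hne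
    apply hx
    refine eq_of_smul_eq T hne ?_ hκx
    have := congrArg f^[p] hκx
    rwa [h.iterate_smul, show φ^[p] κ = κ from hκ] at this
  · exact ⟨Function.iterate_fixed (huv j).1 p, Function.iterate_fixed (huv j).2.1 p,
      (huv j).2.2.mono hAA'⟩
  · exact fun i x _ y _ z _ => transfer_add h p (ε i) x y z
  · exact fun κ hκ i x _ y _ => transfer_smul h p (ε i) ⟨κ, hκ⟩ x y
  · intro i j
    rw [transfer_of_fixed h p (ε i) (huv j).1 (huv j).2.1]
    have : T.orbitPart (fixedSubgroup φ) (ε i) (u j) (v j) =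
        if i = j then Finsupp.single 1 1 else 0 := by
      ext s
      rw [orbitPart_apply, hε s s.2]
      by_cases hij : i = j
      · simp [hij, Finsupp.single_apply, eq_comm]
      · simp [hij]
    unfold weight
    rw [this]
    split_ifs <;> simp

end

end EquivariantTree

namespace EquivariantTree

variable {G V ι : Type*} [Group G] [MulAction G V] {T : EquivariantTree G V ι}
  {φ : G →* G} {f : V → V}

/-- The translates of a set of edges by a subgroup. -/
def orbitSet (K : Subgroup G) (Y : Set (Edge G ι)) : Set (Edge G ι) :=
  {e | ∃ κ ∈ K, ∃ y ∈ Y, κ • y = e}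

theorem smul_mem_orbitSet {K : Subgroup G} {Y : Set (Edge G ι)} {κ : G} (hκ : κ ∈ K)
    {e : Edge G ι} (he : e ∈ orbitSet K Y) : κ • e ∈ orbitSet K Y := by
  obtain ⟨κ', hκ', y, hy, rfl⟩ := he
  exact ⟨κ * κ', mul_mem hκ hκ', y, hy, mul_smul _ _ _⟩

theorem orbitSet_mono {K K' : Subgroup G} (h : K ≤ K') (Y : Set (Edge G ι)) :
    orbitSet K Y ⊆ orbitSet K' Y := by
  rintro e ⟨κ, hκ, y, hy, he⟩
  exact ⟨κ, h hκ, y, hy, he⟩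

theorem HasFamily.iterate (h : T.IsTwist φ f) {Y : Set (Edge G ι)} {n : ℕ}
    (hfam : T.HasFamily (fixedSubgroup φ) (orbitSet (fixedSubgroup φ) Y) {x | f x = x} n)
    (m : ℕ) (hm : m ≠ 0) :
    T.HasFamily (fixedSubgroup (φ.iter m)) (orbitSet (fixedSubgroup (φ.iter m)) Y)
      {x | f^[m] x = x} n := by
  induction m using induction_on_primes with
  | zero => exact (hm rfl).elim
  | one => exact hfam
  | prime_mul p a hp ih =>
    have ih := ih (right_ne_zero_of_mul hm)
    have : Fact p.Prime := ⟨hp⟩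
    rw [mul_comm, MonoidHom.iter_mul, Function.iterate_mul]
    exact HasFamily.prime_step (h.iterate a) p ih (orbitSet_mono (fixedSubgroup_le_iter _ p) Y)
      fun κ hκ e he => smul_mem_orbitSet hκ he

theorem exists_period (φ : G →* G) {Y : Set (Edge G ι)} (hY : Y.Finite) :
    ∃ m, m ≠ 0 ∧ ∀ e ∈ Y, ∀ e' ∈ Y, ∀ g, (∃ t, 0 < t ∧ φ^[t] g = g) → g • e = e' →
      φ^[m] g = g := by
  classical
  have hex : ∀ z : Edge G ι × Edge G ι, ∃ t, t ≠ 0 ∧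
      ∀ g, (∃ t, 0 < t ∧ φ^[t] g = g) → g • z.1 = z.2 → φ^[t] g = g := by
    intro z
    by_cases hz : ∃ g, (∃ t, 0 < t ∧ φ^[t] g = g) ∧ g • z.1 = z.2
    · obtain ⟨g, ⟨t, ht, htg⟩, hg⟩ := hz
      refine ⟨t, ht.ne', fun g' _ hg' => ?_⟩
      rw [← hg] at hg'
      rw [Edge.smul_right_injective z.1 hg', htg]
    · exact ⟨1, one_ne_zero, fun g h1 h2 => (hz ⟨g, h1, h2⟩).elim⟩
  choose t ht htg using hex
  refine ⟨∏ z ∈ hY.toFinset ×ˢ hY.toFinset, t z, Finset.prod_ne_zero_iff.2 fun z _ => ht z,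
    fun e he e' he' g hg hge => ?_⟩
  obtain ⟨d, hd⟩ := Finset.dvd_prod_of_mem t (show (e, e') ∈ hY.toFinset ×ˢ hY.toFinset by
    simp [he, he'])
  rw [hd, Function.iterate_mul]
  exact Function.iterate_fixed (htg (e, e') g hg hge) d

/-- The number of private orbits in a family of geodesics between fixed vertices is bounded by
the number of edge orbits. -/
theorem HasFamily.le_card [Fintype ι] (h : T.IsTwist φ f) {Y : Set (Edge G ι)} (hY : Y.Finite)
    {n : ℕ}
    (hfam : T.HasFamily (fixedSubgroup φ) (orbitSet (fixedSubgroup φ) Y) {x | f x = x} n) :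
    n ≤ Fintype.card ι := by
  classical
  obtain ⟨m, hm, hper⟩ := exists_period φ hY
  obtain ⟨u, v, ε, huv, hε⟩ := HasFamily.iterate h hfam m hm
  refine (h.iterate m).card_le_of_periodic u v (fun j => (huv j).1) (fun j => (huv j).2.1) ε ?_
  rintro g ⟨t, ht, hg⟩ i j
  by_cases hgK : g ∈ fixedSubgroup (φ.iter m)
  · exact hε g hgK i j
  rw [if_neg]
  · by_contra hne
    obtain ⟨κ, hκ, y, hy, hκy⟩ := (huv j).2.2 _ hne
    obtain ⟨κ', hκ', y', hy', hκy'⟩ := (huv i).2.2 (ε i) (by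
      have := hε 1 (one_mem _) i i
      rw [one_smul, if_pos ⟨rfl, rfl⟩] at this
      rw [this]
      exact one_ne_zero)
    have hmem : κ⁻¹ * g * κ' ∈ fixedSubgroup (φ.iter m) := by
      refine hper y' hy' y hy _ ⟨m * t, Nat.mul_pos (Nat.pos_of_ne_zero hm) ht, ?_⟩ ?_
      · have h1 : ∀ k ∈ fixedSubgroup (φ.iter m), φ.iter (m * t) k = k := by
          intro k hk
          rw [MonoidHom.iter_apply, Function.iterate_mul]
          exact Function.iterate_fixed hk t
        have h2 : φ.iter (m * t) g = g := by
          rw [MonoidHom.iter_apply, Function.iterate_mul]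
          exact hg
        change φ.iter (m * t) _ = _
        rw [map_mul, map_mul, h1 _ (inv_mem hκ), h1 _ hκ', h2]
      · rw [mul_smul, mul_smul, hκy', inv_smul_eq_iff, hκy]
    apply hgK
    have := mul_mem (mul_mem hκ hmem) (inv_mem hκ')
    simpa [mul_assoc] using this
  · rintro ⟨-, rfl⟩
    exact hgK (one_mem _)

end EquivariantTree

theorem Subgroup.exists_generators_of_connected {G V : Type*} [Group G] [MulAction G V]
    (H : Subgroup G) {U : Set V} (hU : ∀ h ∈ H, ∀ u ∈ U, h • u ∈ U) {o : V} (hoU : o ∈ U)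
    (ho : ∀ h ∈ H, h • o = o → h = 1) {k : ℕ} (a b : Fin k → V) (ha : ∀ i, a i ∈ U)
    (hb : ∀ i, b i ∈ U)
    (hconn : ∀ P : V → Prop, (∀ h ∈ H, ∀ i, P (h • a i) ↔ P (h • b i)) → P o → ∀ u ∈ U, P u) :
    ∃ (D : Finset V) (S : Finset G), (∀ d ∈ D, d ∈ U) ∧ D.card + S.card ≤ k ∧
      H = Subgroup.closure (S : Set G) ⊔ ⨆ d ∈ D, (MulAction.stabilizer G d ⊓ H) := by
  classical
  let Q : Finset (Fin k) → Finset V → Prop := fun J D => o ∈ D ∧ (∀ d ∈ D, d ∈ U) ∧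
    D.card = J.card + 1 ∧ (∀ d ∈ D, ∀ d' ∈ D, ∀ h ∈ H, h • d = d' → d = d') ∧
    ∀ i ∈ J, ∃ h ∈ H, ∃ d ∈ D, ∃ d' ∈ D, a i = h • d ∧ b i = h • d'
  have hQ0 : Q ∅ {o} := by
    refine ⟨by simp, by simpa using hoU, by simp, ?_, by simp⟩
    intro d hd d' hd' _ _ _
    rw [Finset.mem_singleton.1 hd, Finset.mem_singleton.1 hd']
  obtain ⟨J, ⟨D, hoD, hDU, hcard, hdist, hJ⟩, hmax⟩ :=
    (Set.toFinite {J : Finset (Fin k) | ∃ D, Q J D}).exists_maximal ⟨∅, {o}, hQ0⟩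
  have hins : ∀ i x, i ∉ J → x ∈ U → (∀ h ∈ H, ∀ d ∈ D, h • d ≠ x) →
      (∃ h ∈ H, ∃ d ∈ insert x D, ∃ d' ∈ insert x D, a i = h • d ∧ b i = h • d') → False := by
    intro i x hi hx hxD hab
    refine hi (hmax (y := insert i J) ⟨insert x D, ?_, ?_, ?_, ?_, ?_⟩ (Finset.subset_insert _ _)
      (Finset.mem_insert_self _ _))
    · exact Finset.mem_insert_of_mem hoD
    · intro d hd
      rcases Finset.mem_insert.1 hd with rfl | hd
      · exact hx
      · exact hDU d hd
    · rw [Finset.card_insert_of_notMem hi, Finset.card_insert_of_notMem, hcard]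
      intro h
      exact hxD 1 (one_mem _) x h (one_smul _ _)
    · intro d hd d' hd' h hh hdd
      rw [Finset.mem_insert] at hd hd'
      rcases hd with hd1 | hd1 <;> rcases hd' with hd2 | hd2
      · rw [hd1, hd2]
      · exact (hxD h⁻¹ (inv_mem hh) d' hd2 (by rw [← hdd, inv_smul_smul, hd1])).elim
      · exact (hxD h hh d hd1 (hdd.trans hd2)).elim
      · exact hdist d hd1 d' hd2 h hh hdd
    · intro j hj
      rcases Finset.mem_insert.1 hj with rfl | hj
      · exact hab
      · obtain ⟨h, hh, d, hd, d', hd', h1⟩ := hJ j hj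
        exact ⟨h, hh, d, Finset.mem_insert_of_mem hd, d', Finset.mem_insert_of_mem hd', h1⟩
  have hcover : ∀ u ∈ U, ∃ h ∈ H, ∃ d ∈ D, h • d = u := by
    refine hconn _ (fun h hh i => ?_) ⟨1, one_mem _, o, hoD, one_smul _ _⟩
    by_cases hi : i ∈ J
    · obtain ⟨h', hh', d, hd, d', hd', h1, h2⟩ := hJ i hi
      refine iff_of_true ⟨h * h', mul_mem hh hh', d, hd, ?_⟩ ⟨h * h', mul_mem hh hh', d', hd', ?_⟩
      · rw [h1, mul_smul]
      · rw [h2, mul_smul]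
    constructor
    · rintro ⟨h', hh', d, hd, h1⟩
      by_contra hcon
      have hh'' := mul_mem (inv_mem hh) hh'
      have hai : a i = (h⁻¹ * h') • d := by rw [mul_smul, h1, inv_smul_smul]
      refine hins i ((h⁻¹ * h')⁻¹ • b i) hi (hU _ (inv_mem hh'') _ (hb i)) ?_
        ⟨h⁻¹ * h', hh'', d, Finset.mem_insert_of_mem hd, _, Finset.mem_insert_self _ _, hai,
          (smul_inv_smul _ _).symm⟩
      intro l hl d' hd' h2
      refine hcon ⟨h' * l, mul_mem hh' hl, d', hd', ?_⟩
      rw [mul_smul, h2, smul_smul]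
      simp
    · rintro ⟨h', hh', d, hd, h1⟩
      by_contra hcon
      have hh'' := mul_mem (inv_mem hh) hh'
      have hbi : b i = (h⁻¹ * h') • d := by rw [mul_smul, h1, inv_smul_smul]
      refine hins i ((h⁻¹ * h')⁻¹ • a i) hi (hU _ (inv_mem hh'') _ (ha i)) ?_
        ⟨h⁻¹ * h', hh'', _, Finset.mem_insert_self _ _, d, Finset.mem_insert_of_mem hd,
          (smul_inv_smul _ _).symm, hbi⟩
      intro l hl d' hd' h2
      refine hcon ⟨h' * l, mul_mem hh' hl, d', hd', ?_⟩
      rw [mul_smul, h2, smul_smul]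
      simp
  have hnorm : ∀ i, ∃ h' ∈ H, ∃ s ∈ H, (i ∈ J → s = 1) ∧ ∃ d ∈ D, ∃ d' ∈ D,
      a i = h' • d ∧ b i = (h' * s) • d' := by
    intro i
    by_cases hi : i ∈ J
    · obtain ⟨h', hh', d, hd, d', hd', h1, h2⟩ := hJ i hi
      exact ⟨h', hh', 1, one_mem _, fun _ => rfl, d, hd, d', hd', h1, by rw [mul_one, h2]⟩
    · obtain ⟨h', hh', d, hd, h1⟩ := hcover _ (ha i)
      obtain ⟨h'', hh'', d', hd', h2⟩ := hcover _ (hb i)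
      exact ⟨h', hh', h'⁻¹ * h'', mul_mem (inv_mem hh') hh'', fun h => (hi h).elim, d, hd, d', hd',
        h1.symm, by rw [mul_inv_cancel_left, h2]⟩
  choose h' hh' s hs hsJ d hd d' hd' had hbd using hnorm
  refine ⟨D.erase o, Jᶜ.image s, fun x hx => hDU x (Finset.mem_of_mem_erase hx), ?_, ?_⟩
  · have h1 := Finset.card_erase_of_mem hoD
    have h2 : (Jᶜ.image s).card ≤ Jᶜ.card := Finset.card_image_le
    rw [Finset.card_compl, Fintype.card_fin] at h2
    have h3 := Finset.card_le_univ J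
    rw [Fintype.card_fin] at h3
    omega
  set L := Subgroup.closure ((Jᶜ.image s : Finset G) : Set G) ⊔
    ⨆ d ∈ D.erase o, (MulAction.stabilizer G d ⊓ H) with hL
  have hLH : L ≤ H := by
    refine sup_le ?_ (iSup₂_le fun _ _ => inf_le_right)
    rw [Subgroup.closure_le]
    intro x hx
    obtain ⟨i, -, rfl⟩ := Finset.mem_image.1 (Finset.mem_coe.1 hx)
    exact hs i
  have hstab : ∀ x ∈ D, ∀ h ∈ H, h • x = x → h ∈ L := by
    intro x hx h hh hhx
    by_cases hxo : x = o
    · subst hxo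
      rw [ho h hh hhx]
      exact one_mem _
    · have : MulAction.stabilizer G x ⊓ H ≤ L :=
        le_trans (le_iSup₂_of_le (f := fun d _ => MulAction.stabilizer G d ⊓ H) x
          (Finset.mem_erase.2 ⟨hxo, hx⟩) le_rfl) le_sup_right
      exact this ⟨hhx, hh⟩
  have hsL : ∀ i, s i ∈ L := by
    intro i
    by_cases hi : i ∈ J
    · rw [hsJ i hi]; exact one_mem _
    · refine (le_sup_left : _ ≤ L) (Subgroup.subset_closure ?_)
      exact Finset.mem_coe.2 (Finset.mem_image_of_mem s (by simpa using hi))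
  have hmemL : ∀ l ∈ L, ∀ x ∈ D, ∀ x' ∈ D, ∀ g ∈ H, l • x = g • x' → g ∈ L := by
    intro l hl x hx x' hx' g hg h1
    have h2 : (g⁻¹ * l) • x = x' := by rw [mul_smul, h1, inv_smul_smul]
    have h3 := mul_mem (inv_mem hg) (hLH hl)
    obtain rfl := hdist x hx x' hx' _ h3 h2
    have h4 := mul_mem hl (inv_mem (hstab x hx _ h3 h2))
    simpa using h4
  have hcoverL : ∀ u ∈ U, ∃ l ∈ L, ∃ x ∈ D, l • x = u := by
    refine hconn _ (fun h hh i => ?_) ⟨1, one_mem _, o, hoD, one_smul _ _⟩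
    constructor
    · rintro ⟨l, hl, x, hx, h1⟩
      rw [had, smul_smul] at h1
      have h2 := hmemL l hl x hx _ (hd i) _ (mul_mem hh (hh' i)) h1
      exact ⟨_, mul_mem h2 (hsL i), _, hd' i, by rw [hbd, smul_smul, mul_assoc]⟩
    · rintro ⟨l, hl, x, hx, h1⟩
      rw [hbd, smul_smul, ← mul_assoc] at h1
      have h2 := hmemL l hl x hx _ (hd' i) _ (mul_mem (mul_mem hh (hh' i)) (hs i)) h1
      have h3 := mul_mem h2 (inv_mem (hsL i))
      rw [mul_inv_cancel_right] at h3
      exact ⟨_, h3, _, hd i, by rw [had, smul_smul]⟩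
  refine le_antisymm (fun h hh => ?_) hLH
  obtain ⟨l, hl, x, hx, h1⟩ := hcoverL _ (hU h hh o hoU)
  exact hmemL l hl x hx o hoD h hh h1

namespace EquivariantTree

variable {G V ι : Type*} [Group G] [MulAction G V] {T : EquivariantTree G V ι}
  {φ : G →* G} {f : V → V}

theorem HasFamily.exists_finite {K : Subgroup G} {A : Set (Edge G ι)} {U : Set V} {n : ℕ}
    (h : T.HasFamily K A U n) :
    ∃ Y : Set (Edge G ι), Y.Finite ∧ T.HasFamily K (orbitSet K Y) U n := by
  obtain ⟨u, v, ε, huv, hε⟩ := h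
  refine ⟨⋃ j, ((T.c (u j) (v j)).support : Set (Edge G ι)),
    Set.finite_iUnion fun j => Finset.finite_toSet _, u, v, ε,
    fun j => ⟨(huv j).1, (huv j).2.1, fun e he => ⟨1, one_mem _, e, ?_, one_smul _ _⟩⟩, hε⟩
  exact Set.mem_iUnion.2 ⟨j, by simpa using he⟩

/-- The fixed subgroup is generated by boundedly many elements and point stabilizers. -/
theorem IsTwist.exists_generators [Fintype ι] (h : T.IsTwist φ f) :
    ∃ (D : Finset V) (S : Finset G), (∀ d ∈ D, f d = d) ∧ D.card + S.card ≤ Fintype.card ι ∧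
      fixedSubgroup φ = Subgroup.closure (S : Set G) ⊔
        ⨆ d ∈ D, (MulAction.stabilizer G d ⊓ fixedSubgroup φ) := by
  classical
  set H := fixedSubgroup φ with hH
  have hU : ∀ κ ∈ H, ∀ u ∈ {x | f x = x}, κ • u ∈ {x | f x = x} := fun κ hκ u hu => by
    have := h.map_fixed_smul ⟨κ, hκ⟩ u
    rw [Set.mem_ofPred_eq] at hu ⊢
    rw [hu] at this
    exact this
  obtain ⟨F, hF, hcov⟩ := exists_isMarkedForest T (K := H) (A := Set.univ) (U := {x | f x = x})
    (by simp) hU (fun x hx κ hκ hκx => by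
      by_contra hne
      apply hx
      refine eq_of_smul_eq T hne ?_ hκx
      have := h.map_fixed_smul ⟨κ, hκ⟩ x
      rw [show ((⟨κ, hκ⟩ : H) : G) • x = x from hκx] at this
      exact this.symm)
  obtain ⟨μ, hμU, hμu, hμF, -, hμK⟩ := exists_marking T (by simp) hU hF hcov h.map_o
  have hjoin : ∀ x, ∃ u ∈ {x | f x = x}, T.Joined Set.univ u x := fun x =>
    ⟨T.o, h.map_o, fun _ _ => Set.mem_univ _⟩
  let R : ℕ → Prop := fun k => ∃ ε : Fin k → Edge G ι, (∀ i, ε i ∉ F) ∧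
    ∀ κ ∈ H, ∀ i j, κ • ε i = ε j → i = j
  have hR : ∀ k, R k → k ≤ Fintype.card ι := by
    rintro k ⟨ε, hεF, horb⟩
    obtain ⟨Y, hY, hfam⟩ := (hF.hasFamily hcov ε (by simp) hεF (fun i => hjoin _)
      horb).exists_finite
    exact hfam.le_card h hY
  have hR0 : R 0 := ⟨Fin.elim0, fun i => i.elim0, fun _ _ i => i.elim0⟩
  have hspec := Nat.findGreatest_spec (P := R) (Nat.zero_le (Fintype.card ι)) hR0
  set k := Nat.findGreatest R (Fintype.card ι) with hk
  obtain ⟨ε, hεF, horb⟩ := hspec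
  have hkle : k ≤ Fintype.card ι := Nat.findGreatest_le _
  have hall : ∀ e ∉ F, ∃ κ ∈ H, ∃ i, κ • ε i = e := by
    intro e he
    by_contra hcon
    have hR1 : R (k + 1) := by
      refine ⟨Fin.cons e ε, fun i => ?_, fun κ hκ i j => ?_⟩
      · refine Fin.cases ?_ (fun i => ?_) i
        · exact he
        · exact hεF i
      · refine Fin.cases ?_ (fun i => ?_) i <;> refine Fin.cases ?_ (fun j => ?_) j
        · exact fun _ => rfl
        · intro h1
          exact (hcon ⟨κ⁻¹, inv_mem hκ, j, inv_smul_eq_iff.2 h1.symm⟩).elim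
        · intro h1
          exact (hcon ⟨κ, hκ, i, h1⟩).elim
        · intro h1
          rw [horb κ hκ i j h1]
    have := Nat.le_findGreatest (hR _ hR1) hR1
    omega
  obtain ⟨D, S, hD, hcard, hgen⟩ := Subgroup.exists_generators_of_connected H hU
    (o := T.o) h.map_o (fun g _ hg => T.free g hg) (fun i => μ (T.src (ε i)))
    (fun i => μ (T.tgt (ε i))) (fun i => hμU _) (fun i => hμU _) (fun P hP hPo u hu => by
      have h1 := T.conn (fun x => P (μ x)) (fun g i => by
        by_cases he : (⟨g, i⟩ : Edge G ι) ∈ F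
        · have := hμF _ he
          change μ (g • T.o) = μ (g • T.w i) at this
          rw [this]
        · obtain ⟨κ, hκ, j, hj⟩ := hall _ he
          have h2 := hP κ hκ j
          rw [← hμK κ hκ _ (hjoin _), ← hμK κ hκ _ (hjoin _), ← T.src_smul, ← T.tgt_smul, hj] at h2
          exact h2) (by rw [hμu _ h.map_o]; exact hPo) u
      rwa [hμu u hu] at h1)
  exact ⟨D, S, hD, hcard.trans hkle, hgen⟩

end EquivariantTree

/-- The ping-pong lemma with a base point. -/
theorem Monoid.CoprodI.lift_injective_of_basePoint {κ : Type*} {H : κ → Type*}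
    [∀ i, Group (H i)] {A α : Type*} [Group A] [MulAction A α] (f : ∀ i, H i →* A)
    (X : κ → Set α) (y : α) (hy : ∀ i, y ∉ X i) (hyX : ∀ i, ∀ h ≠ 1, f i h • y ∈ X i)
    (hX : ∀ i j, i ≠ j → ∀ h ≠ 1, ∀ x ∈ X j, f i h • x ∈ X i) :
    Function.Injective (lift f) := by
  classical
  have key : ∀ w : Word H, (w.fstIdx = none → w = Word.empty) ∧
      (w.fstIdx = none → lift f w.prod • y = y) ∧
      ∀ i, w.fstIdx = some i → lift f w.prod • y ∈ X i := by
    intro w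
    induction w using Word.consRecOn with
    | empty => exact ⟨fun _ => rfl, fun _ => by simp, fun i h => by simp [Word.fstIdx] at h⟩
    | cons i m w h1 h2 ih =>
      refine ⟨fun h => by simp at h, fun h => by simp at h, fun j hj => ?_⟩
      rw [Word.fstIdx_cons, Option.some_inj] at hj
      subst hj
      rw [Word.prod_cons, map_mul, lift_of, mul_smul]
      rcases hw : w.fstIdx with _ | j
      · rw [ih.2.1 hw]
        exact hyX i m h2
      · refine hX i j ?_ m h2 _ (ih.2.2 j hw)
        rintro rfl
        exact h1 hw
  rw [injective_iff_map_eq_one]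
  intro g hg
  have hprod : (Word.equiv g).prod = g := Word.equiv.symm_apply_apply g
  rcases hw : (Word.equiv g).fstIdx with _ | j
  · rw [← hprod, (key _).1 hw]
    exact Word.prod_empty
  · have h1 := (key _).2.2 j hw
    rw [hprod, hg, one_smul] at h1
    exact (hy j h1).elim

/-- The free product of two groups as an indexed free product injects. -/
theorem Monoid.Coprod.lift_injective_of_coprodI {A : Type*} [Group A] (K : Bool → Subgroup A)
    (h : Function.Injective (Monoid.CoprodI.lift fun i => (K i).subtype)) :
    Function.Injective (Monoid.Coprod.lift (K true).subtype (K false).subtype) := by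
  let a : Monoid.Coprod (K true) (K false) →* Monoid.CoprodI fun i => K i :=
    Monoid.Coprod.lift (Monoid.CoprodI.of (M := fun i => K i) (i := true))
      (Monoid.CoprodI.of (M := fun i => K i) (i := false))
  let b : (Monoid.CoprodI fun i => K i) →* Monoid.Coprod (K true) (K false) :=
    Monoid.CoprodI.lift fun i => match i with
      | true => Monoid.Coprod.inl
      | false => Monoid.Coprod.inr
  have hba : b.comp a = MonoidHom.id _ := by
    apply Monoid.Coprod.hom_ext <;> ext x <;> simp [a, b]
  have hla : (Monoid.CoprodI.lift fun i => (K i).subtype).comp a =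
      Monoid.Coprod.lift (K true).subtype (K false).subtype := by
    apply Monoid.Coprod.hom_ext <;> ext x <;> simp [a]
  rw [← hla]
  exact h.comp (Function.LeftInverse.injective (g := b) fun x => DFunLike.congr_fun hba x)

/-- A freely indecomposable subgroup generated by two ping-pong players equals one of them. -/
theorem FreelyIndecomposable.eq_bot_or_eq_bot {G : Type u} [Group G] {A : Subgroup G}
    (hA : FreelyIndecomposable A) (K : Bool → Subgroup G) (hK : A = K true ⊔ K false) {α : Type*}
    [MulAction G α] (X : Bool → Set α) (y : α) (hy : ∀ i, y ∉ X i)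
    (hyX : ∀ i, ∀ h ∈ K i, h ≠ 1 → h • y ∈ X i)
    (hX : ∀ i j, i ≠ j → ∀ h ∈ K i, h ≠ 1 → ∀ x ∈ X j, h • x ∈ X i) :
    K true = ⊥ ∨ K false = ⊥ := by
  by_contra! hne
  rw [← Subgroup.nontrivial_iff_ne_bot, ← Subgroup.nontrivial_iff_ne_bot] at hne
  have hinj := Monoid.Coprod.lift_injective_of_coprodI K
    (Monoid.CoprodI.lift_injective_of_basePoint (fun i => (K i).subtype) X y hy
      (fun i h hh => hyX i h h.2 (by simpa using hh))
      (fun i j hij h hh => hX i j hij h h.2 (by simpa using hh)))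
  refine hA.2 (K true) (K false) inferInstance inferInstance hne.1 hne.2
    ⟨((MonoidHom.ofInjective hinj).trans (MulEquiv.subgroupCongr ?_)).symm⟩
  rw [Monoid.Coprod.range_lift, Subgroup.range_subtype, Subgroup.range_subtype, hK]

namespace EquivariantTree

variable {G V ι : Type*} [Group G] [MulAction G V] (T : EquivariantTree G V ι)

theorem c_smul_edge (g : G) (x y : V) (a : G) (ε : Edge G ι) :
    T.c (g • x) (g • y) (a • ε) = T.c x y ((g⁻¹ * a) • ε) := by
  rw [c_smul_apply, mul_smul]

open Classical in
theorem c_src_tgt_apply (ε : Edge G ι) (a : G) :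
    T.c (T.src ε) (T.tgt ε) (a • ε) = if a = 1 then 1 else 0 := by
  rw [c_edge, Finsupp.single_apply]
  simp only [eq_comm (a := ε), Edge.smul_eq_self_iff]

/-- Two edges issuing from the same vertex do not separate a common vertex from it. -/
theorem c_apply_eq_zero_or {v : V} {e₁ e₂ : Edge G ι} (hne : e₁ ≠ e₂)
    (h₁ : T.c v (T.src e₁) e₂ = 0) (h₂ : T.c v (T.src e₂) e₁ = 0) (x : V) :
    T.c v x e₁ = 0 ∨ T.c v x e₂ = 0 := by
  classical
  have hstep : ∀ e e', T.c v (T.tgt e) e' = T.c v (T.src e) e' + if e = e' then 1 else 0 := by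
    intro e e'
    rw [← T.c_add v (T.src e) (T.tgt e), Finsupp.add_apply, c_edge, Finsupp.single_apply]
  have hbase : T.c v x e₁ = 0 ∨ T.c v x e₂ = 0 ↔ T.c v v e₁ = 0 ∨ T.c v v e₂ = 0 := by
    rw [← eq_iff_iff]
    refine T.eq_of_forall_edge (fun z => T.c v z e₁ = 0 ∨ T.c v z e₂ = 0) fun e _ => ?_
    by_cases he1 : e = e₁
    · subst he1
      rw [hstep e e₂, if_neg hne, h₁]
      simp
    · by_cases he2 : e = e₂
      · subst he2
        rw [hstep e e₁, if_neg he1, h₂]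
        simp
      · rw [hstep, hstep, if_neg he1, if_neg he2, add_zero, add_zero]
  exact hbase.2 (by simp [c_self])

/-- The vertices `x`, `y` are not separated by a translate of `ε` under `A`. -/
def Unseparated (A : Subgroup G) (ε : Edge G ι) (x y : V) : Prop :=
  ∀ a ∈ A, T.c x y (a • ε) = 0

variable {T} {A : Subgroup G} {ε : Edge G ι}

theorem Unseparated.refl (x : V) : T.Unseparated A ε x x := fun a _ => by
  rw [c_self, Finsupp.zero_apply]

theorem Unseparated.symm {x y : V} (h : T.Unseparated A ε x y) : T.Unseparated A ε y x :=
  fun a ha => by rw [c_symm, Finsupp.neg_apply, h a ha, neg_zero]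

theorem Unseparated.trans {x y z : V} (h : T.Unseparated A ε x y) (h' : T.Unseparated A ε y z) :
    T.Unseparated A ε x z := fun a ha => by
  rw [← T.c_add x y z, Finsupp.add_apply, h a ha, h' a ha, add_zero]

theorem Unseparated.smul {x y : V} (h : T.Unseparated A ε x y) {g : G} (hg : g ∈ A) :
    T.Unseparated A ε (g • x) (g • y) := fun a ha => by
  rw [c_smul_edge, h _ (mul_mem (inv_mem hg) ha)]

theorem Unseparated.one {x y : V} (h : T.Unseparated A ε x y) : T.c x y ε = 0 := by
  simpa using h 1 (one_mem _)

theorem unseparated_edge {e : Edge G ι} (he : ∀ a ∈ A, a • ε ≠ e) :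
    T.Unseparated A ε (T.src e) (T.tgt e) := by
  classical
  intro a ha
  rw [c_edge, Finsupp.single_apply, if_neg fun h => he a ha h.symm]

variable (T A ε) in
/-- The stabilizer in `A` of a class of vertices not separated by translates of `ε`. -/
def unseparatedStabilizer (x : V) : Subgroup G where
  carrier := {a | a ∈ A ∧ T.Unseparated A ε x (a • x)}
  one_mem' := ⟨one_mem _, by rw [one_smul]; exact .refl _⟩
  mul_mem' {a b} ha hb := ⟨mul_mem ha.1 hb.1, by
    rw [mul_smul]
    exact ha.2.trans (hb.2.smul ha.1)⟩
  inv_mem' {a} ha := ⟨inv_mem ha.1, by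
    have := ha.2.smul (inv_mem ha.1)
    rw [inv_smul_smul] at this
    exact this.symm⟩

theorem unseparatedStabilizer_le (x : V) : T.unseparatedStabilizer A ε x ≤ A := fun _ h => h.1

theorem eq_sup_unseparatedStabilizer
    (hno : ∀ t ∈ A, ¬ T.Unseparated A ε (T.tgt ε) (t • T.src ε)) :
    A = T.unseparatedStabilizer A ε (T.src ε) ⊔ T.unseparatedStabilizer A ε (T.tgt ε) := by
  set L := T.unseparatedStabilizer A ε (T.src ε) ⊔ T.unseparatedStabilizer A ε (T.tgt ε) with hL
  have hLA : L ≤ A := sup_le (unseparatedStabilizer_le _) (unseparatedStabilizer_le _)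
  have hmem : ∀ x, x = T.src ε ∨ x = T.tgt ε → ∀ a ∈ A, ∀ l ∈ L,
      T.Unseparated A ε (a • x) (l • x) → a ∈ L := by
    intro x hx a ha l hl h
    have h1 : a⁻¹ * l ∈ T.unseparatedStabilizer A ε x := by
      refine ⟨mul_mem (inv_mem ha) (hLA hl), ?_⟩
      have := h.smul (inv_mem ha)
      rwa [inv_smul_smul, smul_smul] at this
    have h2 : a⁻¹ * l ∈ L := by
      rcases hx with rfl | rfl
      · exact (le_sup_left : _ ≤ L) h1
      · exact (le_sup_right : _ ≤ L) h1
    have h3 := mul_mem hl (inv_mem h2)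
    simpa using h3
  have hno1 : ∀ a ∈ A, ∀ l ∈ A, ¬ T.Unseparated A ε (a • T.tgt ε) (l • T.src ε) := by
    intro a ha l hl h
    have := h.smul (inv_mem ha)
    rw [inv_smul_smul, smul_smul] at this
    exact hno _ (mul_mem (inv_mem ha) hl) this
  have hcover : ∀ a ∈ A, ∃ l ∈ L, T.Unseparated A ε (a • T.src ε) (l • T.src ε) ∨
      T.Unseparated A ε (a • T.src ε) (l • T.tgt ε) := by
    intro a ha
    have := T.eq_of_forall_edge (fun z => ∃ l ∈ L, T.Unseparated A ε z (l • T.src ε) ∨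
      T.Unseparated A ε z (l • T.tgt ε)) (x := T.src ε) (y := a • T.src ε) fun e _ => ?_
    · exact this.mp ⟨1, one_mem _, Or.inl (by rw [one_smul]; exact .refl _)⟩
    · by_cases he : ∃ b ∈ A, b • ε = e
      · obtain ⟨b, hb, rfl⟩ := he
        rw [eq_iff_iff, T.src_smul, T.tgt_smul]
        constructor
        · rintro ⟨l, hl, h | h⟩
          · exact ⟨b, hmem _ (Or.inl rfl) b hb l hl h, Or.inr (.refl _)⟩
          · exact (hno1 l (hLA hl) b hb h.symm).elim
        · rintro ⟨l, hl, h | h⟩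
          · exact (hno1 b hb l (hLA hl) h).elim
          · exact ⟨b, hmem _ (Or.inr rfl) b hb l hl h, Or.inl (.refl _)⟩
      · push Not at he
        have h := unseparated_edge (T := T) he
        rw [eq_iff_iff]
        exact exists_congr fun l => and_congr_right fun _ =>
          or_congr ⟨h.symm.trans, h.trans⟩ ⟨h.symm.trans, h.trans⟩
  refine le_antisymm (fun a ha => ?_) hLA
  obtain ⟨l, hl, h | h⟩ := hcover a ha
  · exact hmem _ (Or.inl rfl) a ha l hl h
  · exact (hno1 l (hLA hl) a ha h.symm).elim

theorem eq_sup_zpowers {t : G} (ht : t ∈ A)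
    (htε : T.Unseparated A ε (T.tgt ε) (t • T.src ε)) :
    A = T.unseparatedStabilizer A ε (T.src ε) ⊔ Subgroup.zpowers t := by
  set L := T.unseparatedStabilizer A ε (T.src ε) ⊔ Subgroup.zpowers t with hL
  have hLA : L ≤ A := sup_le (unseparatedStabilizer_le _) (by simpa using ht)
  have htL : t ∈ L := (le_sup_right : _ ≤ L) (Subgroup.mem_zpowers t)
  have hmem : ∀ a ∈ A, ∀ l ∈ L,
      T.Unseparated A ε (a • T.src ε) (l • T.src ε) → a ∈ L := by
    intro a ha l hl h
    have h1 : a⁻¹ * l ∈ T.unseparatedStabilizer A ε (T.src ε) := by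
      refine ⟨mul_mem (inv_mem ha) (hLA hl), ?_⟩
      have := h.smul (inv_mem ha)
      rwa [inv_smul_smul, smul_smul] at this
    have h3 := mul_mem hl (inv_mem ((le_sup_left : _ ≤ L) h1))
    simpa using h3
  have hcover : ∀ a ∈ A, ∃ l ∈ L, T.Unseparated A ε (a • T.src ε) (l • T.src ε) := by
    intro a ha
    have := T.eq_of_forall_edge (fun z => ∃ l ∈ L, T.Unseparated A ε z (l • T.src ε))
      (x := T.src ε) (y := a • T.src ε) fun e _ => ?_
    · exact this.mp ⟨1, one_mem _, by rw [one_smul]; exact .refl _⟩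
    · by_cases he : ∃ b ∈ A, b • ε = e
      · obtain ⟨b, hb, rfl⟩ := he
        have h1 := htε.smul hb
        rw [smul_smul] at h1
        rw [eq_iff_iff, T.src_smul, T.tgt_smul]
        constructor
        · rintro ⟨l, hl, h⟩
          exact ⟨b * t, mul_mem (hmem b hb l hl h) htL, h1⟩
        · rintro ⟨l, hl, h⟩
          have h2 := mul_mem (hmem _ (mul_mem hb ht) l hl (h1.symm.trans h)) (inv_mem htL)
          rw [mul_inv_cancel_right] at h2
          exact ⟨b, h2, .refl _⟩
      · push Not at he
        have h := unseparated_edge (T := T) he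
        rw [eq_iff_iff]
        exact exists_congr fun l => and_congr_right fun _ => ⟨h.symm.trans, h.trans⟩
  refine le_antisymm (fun a ha => ?_) hLA
  obtain ⟨l, hl, h⟩ := hcover a ha
  exact hmem a ha l hl h

end EquivariantTree

namespace EquivariantTree

variable {G : Type u} {V ι : Type*} [Group G] [MulAction G V] {T : EquivariantTree G V ι}
  {A : Subgroup G} {ε : Edge G ι}

theorem c_tgt_src_apply (ε : Edge G ι) {a : G} (ha : a ≠ 1) :
    T.c (T.tgt ε) (T.src ε) (a • ε) = 0 := by
  rw [c_symm, Finsupp.neg_apply, c_src_tgt_apply, if_neg ha, neg_zero]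

theorem c_src_tgt_self (ε : Edge G ι) : T.c (T.src ε) (T.tgt ε) ε = 1 := by
  simpa using T.c_src_tgt_apply ε 1

/-- An edge of a tree on which a freely indecomposable group acts without translating the source
to the target has an end point which is not moved across the edge. -/
theorem unseparatedStabilizer_eq_of_forall_not (hA : FreelyIndecomposable A)
    (hno : ∀ t ∈ A, ¬ T.Unseparated A ε (T.tgt ε) (t • T.src ε)) :
    T.unseparatedStabilizer A ε (T.src ε) = A ∨ T.unseparatedStabilizer A ε (T.tgt ε) = A := by
  set B := T.unseparatedStabilizer A ε (T.src ε) with hB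
  set C := T.unseparatedStabilizer A ε (T.tgt ε) with hC
  have hsup : A = B ⊔ C := eq_sup_unseparatedStabilizer hno
  have hst := T.c_src_tgt_self ε
  have hts : T.c (T.tgt ε) (T.src ε) ε = -1 := by rw [c_symm, Finsupp.neg_apply, hst]
  have hinv : ∀ b : G, b ≠ 1 → ε ≠ b⁻¹ • ε := fun b hb h =>
    hb (inv_eq_one.1 (Edge.smul_eq_self_iff.1 h.symm))
  have hBsrc : ∀ b ∈ B, T.c (T.src ε) (b • T.src ε) ε = 0 := fun b hb => hb.2.one
  have hCtgt : ∀ c ∈ C, T.c (T.tgt ε) (c • T.tgt ε) ε = 0 := fun c hc => hc.2.one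
  have hCsrc : ∀ c ∈ C, c ≠ 1 → T.c (T.tgt ε) (c • T.src ε) ε = 0 := by
    intro c hc hc1
    have h1 : T.c (c • T.tgt ε) (c • T.src ε) ε = 0 := by
      rw [c_smul_apply]
      exact c_tgt_src_apply ε (by simpa using hc1)
    rw [← T.c_add _ (c • T.tgt ε), Finsupp.add_apply, h1, hCtgt c hc, add_zero]
  have key := hA.eq_bot_or_eq_bot (fun i => if i then B else C) (by simpa using hsup)
    (fun i => if i then {e | e ≠ ε ∧ T.c (T.tgt ε) (T.src e) ε ≠ 0}
      else {e | e ≠ ε ∧ T.c (T.src ε) (T.src e) ε ≠ 0}) ε (by rintro (_ | _) <;> simp) ?_ ?_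
  · simp only [if_true, Bool.false_eq_true, if_false] at key
    rcases key with h | h
    · right; rw [hsup, h, bot_sup_eq]
    · left; rw [hsup, h, sup_bot_eq]
  · rintro (_ | _) h hh h1
    · simp only [Bool.false_eq_true, if_false] at hh ⊢
      refine ⟨fun h2 => h1 (Edge.smul_eq_self_iff.1 h2), ?_⟩
      rw [T.src_smul, ← T.c_add _ (T.tgt ε), Finsupp.add_apply, hst, hCsrc h hh h1]
      simp
    · simp only [if_true] at hh ⊢
      refine ⟨fun h2 => h1 (Edge.smul_eq_self_iff.1 h2), ?_⟩
      rw [T.src_smul, ← T.c_add _ (T.src ε), Finsupp.add_apply, hts, hBsrc h hh]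
      simp
  · rintro (_ | _) (_ | _) hij h hh h1 e he
    · exact (hij rfl).elim
    · simp only [Bool.false_eq_true, if_false, if_true] at hh he ⊢
      obtain ⟨-, he⟩ := he
      constructor
      · intro h2
        rw [smul_eq_iff_eq_inv_smul] at h2
        rw [h2, T.src_smul, hCsrc _ (inv_mem hh) (by simpa using h1)] at he
        exact he rfl
      · rw [T.src_smul, ← T.c_add _ (T.tgt ε), Finsupp.add_apply, hst,
          ← T.c_add _ (h • T.tgt ε), Finsupp.add_apply, hCtgt h hh, c_smul_apply]
        rcases T.c_apply_eq_zero_or (v := T.tgt ε) (hinv h h1)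
          (c_tgt_src_apply ε (by simpa using h1))
          (by rw [T.src_smul, hCsrc _ (inv_mem hh) (by simpa using h1)]) (T.src e) with h3 | h3
        · exact (he h3).elim
        · rw [h3]; simp
    · simp only [Bool.false_eq_true, if_false, if_true] at hh he ⊢
      obtain ⟨-, he⟩ := he
      constructor
      · intro h2
        rw [smul_eq_iff_eq_inv_smul] at h2
        rw [h2, T.src_smul, hBsrc _ (inv_mem hh)] at he
        exact he rfl
      · rw [T.src_smul, ← T.c_add _ (T.src ε), Finsupp.add_apply, hts,
          ← T.c_add _ (h • T.src ε), Finsupp.add_apply, hBsrc h hh, c_smul_apply]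
        rcases T.c_apply_eq_zero_or (v := T.src ε) (hinv h h1)
          (by rw [c_self, Finsupp.zero_apply])
          (by rw [T.src_smul, hBsrc _ (inv_mem hh)]) (T.src e) with h3 | h3
        · exact (he h3).elim
        · rw [h3]; simp
    · exact (hij rfl).elim

open Classical in
theorem c_zpow_succ {t : G} (ht : t ∈ A) (htε : T.Unseparated A ε (T.tgt ε) (t • T.src ε))
    (k : ℤ) {g : G} (hg : g ∈ A) : T.c (T.src ε) (t ^ (k + 1) • T.src ε) (g • ε) =
      T.c (T.src ε) (t ^ k • T.src ε) (g • ε) + if g = t ^ k then 1 else 0 := by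
  rw [← T.c_add _ (t ^ k • T.src ε) (t ^ (k + 1) • T.src ε), Finsupp.add_apply, zpow_add_one,
    mul_smul, c_smul_edge, ← T.c_add _ (T.tgt ε) (t • T.src ε), Finsupp.add_apply,
    htε _ (mul_mem (inv_mem (zpow_mem ht k)) hg), add_zero, c_src_tgt_apply]
  simp only [inv_mul_eq_one, eq_comm]

theorem c_zpow_of_notMem {t : G} (ht : t ∈ A)
    (htε : T.Unseparated A ε (T.tgt ε) (t • T.src ε))
    (k : ℤ) {g : G} (hg : g ∈ A) (hgt : g ∉ Subgroup.zpowers t) :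
    T.c (T.src ε) (t ^ k • T.src ε) (g • ε) = 0 := by
  have hne : ∀ k : ℤ, g ≠ t ^ k := fun k h => hgt ⟨k, h.symm⟩
  induction k using Int.induction_on with
  | zero => rw [zpow_zero, one_smul, c_self, Finsupp.zero_apply]
  | succ k ih => rw [c_zpow_succ ht htε _ hg, ih, if_neg (hne _), add_zero]
  | pred k ih =>
    have := c_zpow_succ ht htε (-k - 1) hg
    rwa [sub_add_cancel, ih, if_neg (hne _), add_zero, eq_comm] at this

theorem c_pow_pos {t : G} (ht : t ∈ A)
    (htε : T.Unseparated A ε (T.tgt ε) (t • T.src ε)) (n : ℕ) :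
    0 < T.c (T.src ε) (t ^ (n + 1 : ℤ) • T.src ε) ε := by
  have h := fun k => c_zpow_succ ht htε k (one_mem A)
  simp only [one_smul] at h
  induction n with
  | zero =>
    have := h 0
    rw [zpow_zero, if_pos rfl, one_smul, c_self] at this
    rw [Nat.cast_zero, this]
    simp
  | succ n ih =>
    push_cast
    rw [h]
    split_ifs <;> omega

theorem c_pow_neg {t : G} (ht : t ∈ A)
    (htε : T.Unseparated A ε (T.tgt ε) (t • T.src ε)) (n : ℕ) :
    T.c (T.src ε) (t ^ (-n - 1 : ℤ) • T.src ε) (t⁻¹ • ε) < 0 := by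
  have h := fun k => c_zpow_succ ht htε k (inv_mem ht)
  induction n with
  | zero =>
    have := h (-1)
    rw [zpow_neg_one, if_pos rfl, neg_add_cancel, zpow_zero, one_smul, c_self,
      Finsupp.zero_apply] at this
    simp only [Nat.cast_zero, neg_zero, zero_sub, zpow_neg_one]
    omega
  | succ n ih =>
    have := h (-(n + 1 : ℕ) - 1)
    rw [sub_add_cancel] at this
    rw [show (-((n + 1 : ℕ) : ℤ)) = -n - 1 by push_cast; ring] at this ⊢
    split_ifs at this <;> omega

theorem zpow_mem_unseparatedStabilizer {t : G} (ht : t ∈ A)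
    (htε : T.Unseparated A ε (T.tgt ε) (t • T.src ε)) {k : ℤ}
    (hk : t ^ k ∈ T.unseparatedStabilizer A ε (T.src ε)) : k = 0 := by
  rcases lt_trichotomy k 0 with h | h | h
  · obtain ⟨n, rfl⟩ : ∃ n : ℕ, k = -n - 1 := ⟨(-k - 1).toNat, by omega⟩
    have := c_pow_neg ht htε n
    rw [hk.2 _ (inv_mem ht)] at this
    exact (lt_irrefl _ this).elim
  · exact h
  · obtain ⟨n, rfl⟩ : ∃ n : ℕ, k = n + 1 := ⟨(k - 1).toNat, by omega⟩
    have := c_pow_pos ht htε n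
    rw [hk.2.one] at this
    exact (lt_irrefl _ this).elim

/-- A freely indecomposable group translating the source of an edge to its target is cyclic. -/
theorem nonempty_mulEquiv_int (hA : FreelyIndecomposable A) {t : G} (ht : t ∈ A)
    (htε : T.Unseparated A ε (T.tgt ε) (t • T.src ε)) :
    Nonempty (A ≃* Multiplicative ℤ) := by
  set B := T.unseparatedStabilizer A ε (T.src ε) with hB
  set v := T.src ε with hv
  have hsup : A = B ⊔ Subgroup.zpowers t := eq_sup_zpowers ht htε
  have hBt : ∀ b ∈ B, b ≠ 1 → b ∉ Subgroup.zpowers t := by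
    rintro b hb hb1 ⟨k, rfl⟩
    change t ^ k ≠ 1 at hb1
    rw [zpow_mem_unseparatedStabilizer ht htε hb, zpow_zero] at hb1
    exact hb1 rfl
  have hz : ∀ k : ℤ, t ^ k ∈ A := fun k => zpow_mem ht k
  have hbt : ∀ b ∈ B, b ≠ 1 → ∀ k : ℤ, b * t ^ k ∉ Subgroup.zpowers t := by
    intro b hb hb1 k h
    have := mul_mem h (inv_mem (zpow_mem (Subgroup.mem_zpowers t) k))
    rw [mul_inv_cancel_right] at this
    exact hBt b hb hb1 this
  have hcross : ∀ x : V, (∃ b ∈ B, b ≠ 1 ∧ (T.c v x (b • ε) ≠ 0 ∨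
      T.c v x ((b * t⁻¹) • ε) ≠ 0)) → ∀ k : ℤ, T.c v x (t ^ k • ε) = 0 := by
    have h1 : ∀ b ∈ B, b ≠ 1 → ∀ j k : ℤ, T.c v ((b * t ^ j) • v) (t ^ k • ε) = 0 := by
      intro b hb hb1 j k
      have hb2 := hbt b⁻¹ (inv_mem hb) (by simpa using hb1) k
      rw [← T.c_add _ (b • v), Finsupp.add_apply, hb.2 _ (hz k), mul_smul, c_smul_edge,
        c_zpow_of_notMem ht htε j (mul_mem (inv_mem hb.1) (hz k)) hb2, add_zero]
    have h2 : ∀ b ∈ B, b ≠ 1 → ∀ j : ℤ, ∀ x : V, T.c v x ((b * t ^ j) • ε) ≠ 0 →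
        ∀ k : ℤ, T.c v x (t ^ k • ε) = 0 := by
      intro b hb hb1 j x hx k
      refine (T.c_apply_eq_zero_or ?_ ?_ ?_ x).resolve_left hx
      · intro h
        exact hbt b hb hb1 j ⟨k, (Edge.smul_right_injective ε h).symm⟩
      · rw [T.src_smul]
        exact h1 b hb hb1 j k
      · rw [T.src_smul]
        exact c_zpow_of_notMem ht htε k (mul_mem hb.1 (hz j)) (hbt b hb hb1 j)
    rintro x ⟨b, hb, hb1, h | h⟩ k
    · exact h2 b hb hb1 0 x (by simpa using h) k
    · exact h2 b hb hb1 (-1) x (by simpa using h) k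
  have hmove : ∀ k : ℤ, k ≠ 0 → ∀ x : V, (∀ k : ℤ, T.c v x (t ^ k • ε) = 0) →
      T.c v (t ^ k • x) ε ≠ 0 ∨ T.c v (t ^ k • x) (t⁻¹ • ε) ≠ 0 := by
    intro k hk x hx
    have h1 : ∀ j : ℤ, T.c v (t ^ k • x) (t ^ j • ε) = T.c v (t ^ k • v) (t ^ j • ε) := by
      intro j
      rw [← T.c_add _ (t ^ k • v), Finsupp.add_apply, c_smul_edge, ← zpow_neg, ← zpow_add, hx,
        add_zero]
    rcases lt_or_gt_of_ne hk with h | h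
    · right
      obtain ⟨n, rfl⟩ : ∃ n : ℕ, k = -n - 1 := ⟨(-k - 1).toNat, by omega⟩
      rw [← zpow_neg_one, h1, zpow_neg_one]
      exact (c_pow_neg ht htε n).ne
    · left
      obtain ⟨n, rfl⟩ : ∃ n : ℕ, k = n + 1 := ⟨(k - 1).toNat, by omega⟩
      have h2 := h1 0
      rw [zpow_zero, one_smul] at h2
      rw [h2]
      exact (c_pow_pos ht htε n).ne'
  have key := hA.eq_bot_or_eq_bot (fun i => if i then B else Subgroup.zpowers t)
    (by simpa using hsup)
    (fun i => if i then {e | ∃ b ∈ B, b ≠ 1 ∧ (e = b • ε ∨ T.c v (T.src e) (b • ε) ≠ 0 ∨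
        T.c v (T.src e) ((b * t⁻¹) • ε) ≠ 0)}
      else {e | T.c v (T.src e) ε ≠ 0 ∨ T.c v (T.src e) (t⁻¹ • ε) ≠ 0}) ε ?_ ?_ ?_
  · simp only [if_true, Bool.false_eq_true, if_false] at key
    have hinf : ∀ k : ℤ, t ^ k = 1 → k = 0 := fun k hk =>
      zpow_mem_unseparatedStabilizer ht htε (hk ▸ one_mem B)
    have ht1 : t ≠ 1 := fun h => by simpa using hinf 1 (by simpa using h)
    rcases key with h | h
    · rw [h, bot_sup_eq] at hsup
      have hinj : Function.Injective (zpowersHom G t) := by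
        rw [injective_iff_map_eq_one]
        intro k hk
        exact hinf k.toAdd hk
      refine ⟨((MonoidHom.ofInjective hinj).trans (MulEquiv.subgroupCongr ?_)).symm⟩
      rw [hsup]
      rfl
    · exact (ht1 (Subgroup.zpowers_eq_bot.1 h)).elim
  · rintro (_ | _)
    · simp [← hv, c_self]
    · simp only [if_true]
      rintro ⟨b, -, hb1, h | h | h⟩
      · exact hb1 (Edge.smul_eq_self_iff.1 h.symm)
      · simp [← hv, c_self] at h
      · simp [← hv, c_self] at h
  · rintro (_ | _) h hh h1
    · simp only [Bool.false_eq_true, if_false] at hh ⊢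
      obtain ⟨k, rfl⟩ := hh
      have := hmove k (by rintro rfl; simp at h1) v (fun k => by rw [c_self]; rfl)
      change T.c v (T.src (t ^ k • ε)) _ ≠ 0 ∨ T.c v (T.src (t ^ k • ε)) _ ≠ 0
      rwa [T.src_smul]
    · simp only [if_true] at hh ⊢
      exact ⟨h, hh, h1, Or.inl rfl⟩
  · rintro (_ | _) (_ | _) hij h hh h1 e he
    · exact (hij rfl).elim
    · simp only [Bool.false_eq_true, if_false, if_true] at hh he ⊢
      obtain ⟨k, rfl⟩ := hh
      change T.c v (T.src (t ^ k • e)) _ ≠ 0 ∨ T.c v (T.src (t ^ k • e)) _ ≠ 0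
      rw [T.src_smul]
      refine hmove k (by rintro rfl; simp at h1) _ ?_
      obtain ⟨b, hb, hb1, rfl | he⟩ := he
      · intro j
        rw [T.src_smul]
        exact hb.2 _ (hz j)
      · exact hcross _ ⟨b, hb, hb1, he⟩
    · simp only [Bool.false_eq_true, if_false, if_true] at hh he ⊢
      have h2 : ∀ a ∈ A, T.c v (h • T.src e) ((h * a) • ε) = T.c v (T.src e) (a • ε) := by
        intro a ha
        rw [← T.c_add _ (h • v), Finsupp.add_apply, hh.2 _ (mul_mem hh.1 ha), zero_add,
          c_smul_edge, inv_mul_cancel_left]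
      refine ⟨h, hh, h1, Or.inr ?_⟩
      rw [T.src_smul, h2 _ (inv_mem ht)]
      have h3 := h2 1 (one_mem _)
      rw [mul_one, one_smul] at h3
      rw [h3]
      exact he
    · exact (hij rfl).elim

theorem Joined.src {F : Set (Edge G ι)} {x y : V} (h : T.Joined F x y)
    (hε : T.c x y ε ≠ 0) : T.Joined F x (T.src ε) := by
  classical
  by_contra hcon
  have hx : ¬ T.Joined F (T.src ε) x := fun h => hcon h.symm
  have hy : ¬ T.Joined F (T.src ε) y := fun h1 => hx (h1.trans h.symm)
  have h1 := T.sub_eq_sum (fun z => if T.Joined F (T.src ε) z then T.c (T.src ε) z ε else 0) x y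
  rw [if_neg hx, if_neg hy, sub_self, Finsupp.sum, Finset.sum_eq_single ε] at h1
  · rw [if_pos (Joined.refl F _), if_pos (joined_edge (h ε hε)), c_self, c_src_tgt_self] at h1
    simp at h1
    exact hε h1.symm
  · intro e he hne
    have he' : T.Joined F (T.src e) (T.tgt e) := joined_edge (h e (by simpa using he))
    by_cases h2 : T.Joined F (T.src ε) (T.src e)
    · rw [if_pos h2, if_pos (h2.trans he'), ← T.c_add (T.src ε) (T.src e) (T.tgt e),
        Finsupp.add_apply, c_edge, Finsupp.single_apply, if_neg hne]
      simp
    · rw [if_neg h2, if_neg fun h3 => h2 (h3.trans he'.symm)]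
      simp
  · intro h2
    exact (hε (by simpa using h2)).elim

/-- A finitely generated, freely indecomposable, non-cyclic group fixes a vertex. -/
theorem exists_forall_smul_eq (T : EquivariantTree G V ι) (hA : FreelyIndecomposable A)
    (hZ : ¬ Nonempty (A ≃* Multiplicative ℤ)) (hfg : A.FG) :
    ∃ x : V, ∀ a ∈ A, a • x = x := by
  classical
  have hcollapse : ∀ ε : Edge G ι, ∃ x, (x = T.src ε ∨ x = T.tgt ε) ∧
      ∀ a ∈ A, T.c x (a • x) ε = 0 := by
    intro ε
    have hstab : ∀ x, T.unseparatedStabilizer A ε x = A → ∀ a ∈ A, T.c x (a • x) ε = 0 := by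
      intro x hx a ha
      rw [← hx] at ha
      exact ha.2.one
    rcases unseparatedStabilizer_eq_of_forall_not (ε := ε) (T := T) hA
      fun t ht htε => hZ (nonempty_mulEquiv_int hA ht htε) with h | h
    · exact ⟨_, Or.inl rfl, hstab _ h⟩
    · exact ⟨_, Or.inr rfl, hstab _ h⟩
  have hind : ∀ (N : Finset (Edge G ι)) (x : V),
      (∀ a ∈ A, T.Joined (orbitSet A (N : Set (Edge G ι))) x (a • x)) →
      ∃ x : V, ∀ a ∈ A, a • x = x := by
    intro N
    induction N using Finset.induction_on with
    | empty =>
      intro x hx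
      refine ⟨x, fun a ha => (T.eq_of_c_eq_zero ?_).symm⟩
      ext e
      by_contra h
      obtain ⟨_, _, y, hy, _⟩ := hx a ha e h
      simp at hy
    | insert ε N hε ih =>
      intro x hx
      have hFA : ∀ a ∈ A, ∀ e ∈ orbitSet A ((insert ε N : Finset _) : Set (Edge G ι)),
          a • e ∈ orbitSet A ((insert ε N : Finset _) : Set (Edge G ι)) :=
        fun a ha e he => smul_mem_orbitSet ha he
      have hεF : ε ∈ orbitSet A ((insert ε N : Finset _) : Set (Edge G ι)) :=
        ⟨1, one_mem _, ε, by simp, one_smul _ _⟩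
      obtain ⟨z, hz, hzε⟩ : ∃ z, (∀ a ∈ A, T.Joined
          (orbitSet A ((insert ε N : Finset _) : Set (Edge G ι))) z (a • z)) ∧
          ∀ a ∈ A, T.c z (a • z) ε = 0 := by
        by_cases hall : ∀ a ∈ A, T.c x (a • x) ε = 0
        · exact ⟨x, hx, hall⟩
        push Not at hall
        obtain ⟨b, hb, hbε⟩ := hall
        have hsrc := (hx b hb).src hbε
        obtain ⟨z, hz, hzε⟩ := hcollapse ε
        refine ⟨z, fun a ha => ?_, hzε⟩
        have hxz : T.Joined (orbitSet A ((insert ε N : Finset _) : Set (Edge G ι))) x z := by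
          rcases hz with rfl | rfl
          · exact hsrc
          · exact hsrc.trans (joined_edge hεF)
        exact (hxz.symm.trans (hx a ha)).trans (hxz.smul (hFA a ha))
      refine ih z fun a ha e he => ?_
      obtain ⟨κ, hκ, y, hy, rfl⟩ := hz a ha e he
      rcases Finset.mem_insert.1 (Finset.mem_coe.1 hy) with rfl | hy
      · exfalso
        apply he
        rw [← T.c_add _ (κ • z), Finsupp.add_apply, ← mul_inv_cancel_left κ a, mul_smul κ,
          T.c_smul, hzε _ (mul_mem (inv_mem hκ) ha), add_zero, c_symm, Finsupp.neg_apply,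
          neg_eq_zero]
        have h1 := T.c_smul κ z (κ⁻¹ • z) y
        rwa [smul_inv_smul, hzε _ (inv_mem hκ)] at h1
      · exact ⟨κ, hκ, y, hy, rfl⟩
  obtain ⟨S, hS⟩ := hfg
  refine hind (S.biUnion fun s => (T.c T.o (s • T.o)).support) T.o ?_
  set F := orbitSet A ((S.biUnion fun s => (T.c T.o (s • T.o)).support : Finset _) :
    Set (Edge G ι)) with hF
  have hFA : ∀ a ∈ A, ∀ e ∈ F, a • e ∈ F := fun a ha e he => smul_mem_orbitSet ha he
  intro a ha
  suffices h : a ∈ A ∧ T.Joined F T.o (a • T.o) from h.2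
  rw [← hS] at ha
  induction ha using Subgroup.closure_induction with
  | mem s hs =>
    refine ⟨hS ▸ Subgroup.subset_closure hs, fun e he => ⟨1, one_mem _, e, ?_, one_smul _ _⟩⟩
    rw [Finset.mem_coe, Finset.mem_biUnion]
    exact ⟨s, hs, by simpa using he⟩
  | one => exact ⟨one_mem _, by rw [one_smul]; exact .refl _ _⟩
  | mul a b _ _ ha hb =>
    refine ⟨mul_mem ha.1 hb.1, ?_⟩
    rw [mul_smul]
    exact ha.2.trans (hb.2.smul (hFA a ha.1))
  | inv a _ ha =>
    refine ⟨inv_mem ha.1, ?_⟩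
    have := ha.2.smul (hFA _ (inv_mem ha.1))
    rw [inv_smul_smul] at this
    exact this.symm

end EquivariantTree

namespace Monoid.CoprodI

variable {κ : Type*} {H : κ → Type*} [∀ i, Group (H i)]

/-- Left translation of chains of edges. -/
noncomputable def chainSMul (g : CoprodI H) :
    (Edge (CoprodI H) κ →₀ ℤ) ≃+ (Edge (CoprodI H) κ →₀ ℤ) :=
  Finsupp.domCongr (MulAction.toPerm g)

theorem chainSMul_apply (g : CoprodI H) (x : Edge (CoprodI H) κ →₀ ℤ) (e : Edge (CoprodI H) κ) :
    chainSMul g x e = x (g⁻¹ • e) := rfl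

theorem chainSMul_mul (g h : CoprodI H) (x : Edge (CoprodI H) κ →₀ ℤ) :
    chainSMul (g * h) x = chainSMul g (chainSMul h x) := by
  ext e
  simp only [chainSMul_apply, mul_inv_rev, mul_smul]

theorem chainSMul_one (x : Edge (CoprodI H) κ →₀ ℤ) : chainSMul 1 x = x := by
  ext e
  simp [chainSMul_apply]

/-- The affine action of a free product on chains of edges whose translation part is the geodesic
from the base vertex. The infinite cyclic factors singled out by `z` act by a loop. -/
noncomputable def affine (z : ∀ i, Option (H i ≃* Multiplicative ℤ)) :
    CoprodI H →* Equiv.Perm (Edge (CoprodI H) κ →₀ ℤ) :=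
  lift fun i => match z i with
    | none =>
      { toFun a := ⟨fun x => chainSMul (of a) (x - .single ⟨1, i⟩ 1) + .single ⟨1, i⟩ 1,
          fun x => chainSMul (of a⁻¹) (x - .single ⟨1, i⟩ 1) + .single ⟨1, i⟩ 1,
          fun x => by
            beta_reduce
            rw [add_sub_cancel_right, ← chainSMul_mul, ← map_mul, inv_mul_cancel, map_one,
              chainSMul_one, sub_add_cancel],
          fun x => by
            beta_reduce
            rw [add_sub_cancel_right, ← chainSMul_mul, ← map_mul, mul_inv_cancel, map_one,
              chainSMul_one, sub_add_cancel]⟩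
        map_one' := by
          ext1 x
          change chainSMul (of 1) _ + _ = x
          rw [map_one, chainSMul_one, sub_add_cancel]
        map_mul' a b := by
          ext1 x
          change chainSMul (of (a * b)) _ + _ = chainSMul (of a) (_ + _ - _) + _
          rw [add_sub_cancel_right, map_mul, chainSMul_mul] }
    | some t => (zpowersHom _ ((chainSMul (of (t.symm (.ofAdd 1)))).toEquiv.trans
        (Equiv.addLeft (.single ⟨1, i⟩ 1)))).comp t.toMonoidHom

variable {z : ∀ i, Option (H i ≃* Multiplicative ℤ)}

theorem affine_of_none {i : κ} (hi : z i = none) (a : H i) (x : Edge (CoprodI H) κ →₀ ℤ) :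
    affine z (of a) x = chainSMul (of a) (x - .single ⟨1, i⟩ 1) + .single ⟨1, i⟩ 1 := by
  rw [affine, lift_of]
  split
  · rfl
  · simp_all

theorem affine_of_some {i : κ} {t : H i ≃* Multiplicative ℤ} (hi : z i = some t)
    (x : Edge (CoprodI H) κ →₀ ℤ) : affine z (of (t.symm (.ofAdd 1))) x =
      .single ⟨1, i⟩ 1 + chainSMul (of (t.symm (.ofAdd 1))) x := by
  rw [affine, lift_of]
  split
  · simp_all
  · rename_i t' ht'
    obtain rfl : t = t' := Option.some_inj.1 (hi.symm.trans ht')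
    simp

/-- A subgroup of a free product contains everything if it contains the factors, it being enough
to have a generator of the infinite cyclic factors. -/
theorem eq_top_of_forall_mem (z : ∀ i, Option (H i ≃* Multiplicative ℤ))
    (S : Subgroup (CoprodI H)) (h₁ : ∀ i, z i = none → ∀ a : H i, of a ∈ S)
    (h₂ : ∀ i t, z i = some t → of (t.symm (.ofAdd 1)) ∈ S) (g : CoprodI H) : g ∈ S := by
  induction g using CoprodI.induction_on with
  | one => exact one_mem _
  | of i a =>
    rcases hi : z i with _ | t
    · exact h₁ i hi a
    · have h3 : a = t.symm (.ofAdd 1) ^ (t a).toAdd := by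
        rw [← map_zpow, ← ofAdd_zsmul, smul_eq_mul, mul_one, ofAdd_toAdd, MulEquiv.symm_apply_apply]
      rw [h3, map_zpow]
      exact zpow_mem (h₂ i t hi) _
  | mul x y hx hy => exact mul_mem hx hy

theorem affine_apply (g : CoprodI H) (x : Edge (CoprodI H) κ →₀ ℤ) :
    affine z g x = affine z g 0 + chainSMul g x := by
  let S : Subgroup (CoprodI H) :=
    { carrier := {g | ∀ x, affine z g x = affine z g 0 + chainSMul g x}
      one_mem' := fun x => by simp [chainSMul_one]
      mul_mem' := fun {a b} ha hb x => by
        rw [map_mul, Equiv.Perm.mul_apply, Equiv.Perm.mul_apply, ha, hb, ha (affine z b 0),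
          chainSMul_mul, map_add, add_assoc]
      inv_mem' := fun {a} ha x => by
        rw [map_inv, Equiv.Perm.inv_eq_iff_eq, ha, map_add, ← add_assoc, ← ha,
          ← Equiv.Perm.mul_apply, mul_inv_cancel, Equiv.Perm.one_apply, zero_add, ← chainSMul_mul,
          mul_inv_cancel, chainSMul_one] }
  refine eq_top_of_forall_mem z S (fun i hi a x => ?_) (fun i t hi x => ?_) g x
  · rw [affine_of_none hi, affine_of_none hi, map_sub, map_sub, map_zero]
    abel
  · rw [affine_of_some hi, affine_of_some hi, map_zero, add_zero]

variable (z) in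
/-- The vertices of the Bass–Serre tree of a free product. -/
abbrev TreeVertex : Type _ :=
  CoprodI H ⊕ Σ i : {i // z i = none}, CoprodI H ⧸ (of (M := H) (i := i.1)).range

/-- The geodesic from the base vertex. -/
noncomputable def treeGeodesic : TreeVertex z → Edge (CoprodI H) κ →₀ ℤ
  | .inl g => affine z g 0
  | .inr ⟨i, q⟩ => Quotient.liftOn' q (fun g => affine z g (.single ⟨1, i⟩ 1)) (by
      intro a b hab
      rw [QuotientGroup.leftRel_apply] at hab
      obtain ⟨h, hh⟩ := hab
      rw [eq_inv_mul_iff_mul_eq] at hh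
      rw [← hh, map_mul, Equiv.Perm.mul_apply, affine_of_none i.2, sub_self, map_zero, zero_add])

theorem treeGeodesic_smul (g : CoprodI H) (x : TreeVertex z) :
    treeGeodesic (g • x) = affine z g (treeGeodesic x) := by
  rcases x with h | ⟨i, q⟩
  · change affine z (g * h) 0 = _
    rw [map_mul]
    rfl
  · induction q using QuotientGroup.induction_on with
    | _ h =>
      change affine z (g * h) _ = _
      rw [map_mul]
      rfl

variable (z) in
/-- The ends of the edges issuing from the base vertex. -/
noncomputable def treeTip (i : κ) : TreeVertex z :=
  match hi : z i with
  | none => .inr ⟨⟨i, hi⟩, (1 : CoprodI H)⟩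
  | some t => .inl (of (t.symm (.ofAdd 1)))

theorem treeTip_of_none {i : κ} (hi : z i = none) :
    treeTip z i = .inr ⟨⟨i, hi⟩, (1 : CoprodI H)⟩ := by
  rw [treeTip]
  split
  · rfl
  · simp_all

theorem treeTip_of_some {i : κ} {t : H i ≃* Multiplicative ℤ} (hi : z i = some t) :
    treeTip z i = .inl (of (t.symm (.ofAdd 1))) := by
  rw [treeTip]
  split
  · simp_all
  · rename_i t' ht'
    obtain rfl : t = t' := Option.some_inj.1 (hi.symm.trans ht')
    rfl

theorem smul_inl (g h : CoprodI H) : g • (.inl h : TreeVertex z) = .inl (g * h) := rfl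

theorem smul_inr (g h : CoprodI H) (i : {i // z i = none}) :
    g • (.inr ⟨i, h⟩ : TreeVertex z) = .inr ⟨i, (g * h : CoprodI H)⟩ := rfl

variable (z) in
/-- The Bass–Serre tree of a free product. -/
noncomputable def tree : EquivariantTree (CoprodI H) (TreeVertex z) κ where
  o := .inl 1
  w := treeTip z
  c x y := treeGeodesic y - treeGeodesic x
  c_add x y z := by abel
  c_smul g x y e := by
    rw [treeGeodesic_smul, treeGeodesic_smul, affine_apply, affine_apply g (treeGeodesic x),
      add_sub_add_left_eq_sub, ← map_sub, chainSMul_apply, inv_smul_smul]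
  c_tip i := by
    have h1 : treeGeodesic (.inl 1 : TreeVertex z) = 0 := by
      change affine z 1 0 = 0
      simp
    rw [h1, sub_zero]
    rcases hi : z i with _ | t
    · rw [treeTip_of_none hi]
      change affine z 1 _ = _
      simp
    · rw [treeTip_of_some hi]
      change affine z _ 0 = _
      rw [affine_of_some hi, map_zero, add_zero]
  conn P hP hPo := by
    have hP1 : ∀ i (hi : z i = none) (g : CoprodI H), P (.inl g) ↔ P (.inr ⟨⟨i, hi⟩, g⟩) := by
      intro i hi g
      have := hP g i
      rwa [treeTip_of_none hi, smul_inl, smul_inr, mul_one] at this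
    have hP2 : ∀ i t, z i = some t → ∀ g : CoprodI H,
        P (.inl g) ↔ P (.inl (g * of (t.symm (.ofAdd 1)))) := by
      intro i t hi g
      have := hP g i
      rwa [treeTip_of_some hi, smul_inl, smul_inl, mul_one] at this
    let S : Subgroup (CoprodI H) :=
      { carrier := {a | ∀ g, P (.inl g) ↔ P (.inl (g * a))}
        one_mem' := fun g => by rw [mul_one]
        mul_mem' := fun {a b} ha hb g => by rw [← mul_assoc, ← hb, ← ha]
        inv_mem' := fun {a} ha g => by rw [ha (g * a⁻¹), inv_mul_cancel_right] }
    have hS : ∀ a, a ∈ S := eq_top_of_forall_mem z S (fun i hi a g => by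
        rw [hP1 i hi, hP1 i hi]
        have : ((g * of a : CoprodI H) : CoprodI H ⧸ (of (M := H) (i := i)).range) = g :=
          QuotientGroup.mk_mul_of_mem _ ⟨a, rfl⟩
        rw [this]) (fun i t hi g => hP2 i t hi g)
    have hl : ∀ g, P (.inl g) := fun g => by
      have := (hS g 1).1 hPo
      rwa [one_mul] at this
    rintro (g | ⟨i, q⟩)
    · exact hl g
    · induction q using QuotientGroup.induction_on with
      | _ g => exact (hP1 i.1 i.2 g).1 (hl g)
  free g hg := by
    have : (Sum.inl (g * 1) : TreeVertex z) = .inl 1 := hg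
    simpa using this

end Monoid.CoprodI

theorem FreelyIndecomposable.of_mulEquiv {A B : Type u} [Group A] [Group B] (e : A ≃* B)
    (h : FreelyIndecomposable A) : FreelyIndecomposable B := by
  have := h.1
  exact ⟨e.symm.toEquiv.nontrivial, fun C D _ _ hC hD ⟨e'⟩ => h.2 C D _ _ hC hD ⟨e.trans e'⟩⟩

namespace Monoid.CoprodI

variable {κ : Type u} {H : κ → Type u} [∀ i, Group (H i)]

theorem mem_stabilizer_inr {z : ∀ i, Option (H i ≃* Multiplicative ℤ)} {i : {i // z i = none}}
    {g p : CoprodI H} :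
    p ∈ MulAction.stabilizer (CoprodI H) (.inr ⟨i, g⟩ : TreeVertex z) ↔
      ∃ a : H i, p = g * of a * g⁻¹ := by
  rw [MulAction.mem_stabilizer_iff, smul_inr, Sum.inr.injEq, Sigma.mk.injEq, heq_eq_eq,
    and_iff_right rfl, eq_comm, QuotientGroup.eq, MonoidHom.mem_range]
  refine exists_congr fun a => ?_
  rw [eq_inv_mul_iff_mul_eq, eq_mul_inv_iff_mul_eq, eq_comm]

/-- An injective endomorphism of a free product of freely indecomposable groups twists its
Bass–Serre tree. -/
theorem exists_isTwist (z : ∀ i, Option (H i ≃* Multiplicative ℤ))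
    (hz : ∀ i, z i = none → ¬ Nonempty (H i ≃* Multiplicative ℤ))
    (hind : ∀ i, FreelyIndecomposable (H i)) (hfg : ∀ i, Group.FG (H i))
    {φ : CoprodI H →* CoprodI H} (hφ : Function.Injective φ) :
    ∃ f, (tree z).IsTwist φ f := by
  have key : ∀ i : {i // z i = none}, ∃ x : TreeVertex z, ∀ a : H i, φ (of a) • x = x := by
    intro i
    have e : H i ≃* (φ.comp (of (M := H) (i := i.1))).range :=
      MonoidHom.ofInjective (hφ.comp (of_injective i.1))
    obtain ⟨x, hx⟩ := EquivariantTree.exists_forall_smul_eq (tree z)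
      ((hind i).of_mulEquiv e) (fun ⟨e'⟩ => hz i i.2 ⟨e.trans e'⟩)
      ((Group.fg_iff_subgroup_fg _).1
        (Group.fg_of_surjective (hG := hfg i) (f := e.toMonoidHom) e.surjective))
    exact ⟨x, fun a => hx _ ⟨a, rfl⟩⟩
  choose x hx using key
  refine ⟨Sum.elim (fun g => .inl (φ g)) fun p => Quotient.liftOn' p.2 (fun g => φ g • x p.1) ?_,
    hφ, ?_, ?_⟩
  · intro a b hab
    rw [QuotientGroup.leftRel_apply] at hab
    obtain ⟨h, hh⟩ := hab
    rw [eq_inv_mul_iff_mul_eq] at hh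
    rw [← hh, map_mul, mul_smul, hx]
  · rintro g (p | ⟨i, q⟩)
    · change Sum.inl (φ (g * p)) = _
      rw [map_mul]
      rfl
    · induction q using QuotientGroup.induction_on with
      | _ p =>
        change φ (g * p) • x i = φ g • φ p • x i
        rw [map_mul, mul_smul]
  · change Sum.inl (φ 1) = _
    rw [map_one]
    rfl

theorem stabilizer_inl {z : ∀ i, Option (H i ≃* Multiplicative ℤ)} (g : CoprodI H) :
    MulAction.stabilizer (CoprodI H) (.inl g : TreeVertex z) = ⊥ := by
  refine (Subgroup.eq_bot_iff_forall _).2 fun p hp => ?_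
  rw [MulAction.mem_stabilizer_iff, smul_inl, Sum.inl.injEq] at hp
  simpa using hp

/-- The fixed elements of a vertex stabilizer form the fixed subgroup of an injective
endomorphism of a factor. -/
theorem exists_map_fixedSubgroup {z : ∀ i, Option (H i ≃* Multiplicative ℤ)}
    {φ : CoprodI H →* CoprodI H} {f : TreeVertex z → TreeVertex z} (hf : (tree z).IsTwist φ f)
    {i : {i // z i = none}} {g : CoprodI H} (hfix : f (.inr ⟨i, g⟩) = .inr ⟨i, g⟩) :
    ∃ (α : H i →* H i) (β : H i →* CoprodI H), Function.Injective α ∧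
      (fixedSubgroup α).map β =
        MulAction.stabilizer (CoprodI H) (.inr ⟨i, g⟩ : TreeVertex z) ⊓ fixedSubgroup φ := by
  let β : H i →* CoprodI H := (MulAut.conj g).toMonoidHom.comp of
  have hβ : Function.Injective β := (MulAut.conj g).injective.comp (of_injective i.1)
  have hmem : ∀ p, p ∈ MulAction.stabilizer (CoprodI H) (.inr ⟨i, g⟩ : TreeVertex z) ↔
      p ∈ β.range := fun p => by
    rw [mem_stabilizer_inr, MonoidHom.mem_range]
    exact exists_congr fun a => eq_comm
  have hφβ : ∀ a, φ (β a) ∈ β.range := fun a => by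
    have h1 := (hmem (β a)).2 ⟨a, rfl⟩
    rw [← hmem, MulAction.mem_stabilizer_iff]
    rw [MulAction.mem_stabilizer_iff] at h1
    have h2 := hf.map_smul (β a) (.inr ⟨i, g⟩)
    rw [h1, hfix] at h2
    exact h2.symm
  let e := MonoidHom.ofInjective hβ
  let α : H i →* H i := e.symm.toMonoidHom.comp ((φ.comp β).codRestrict β.range hφβ)
  have hα : ∀ a, β (α a) = φ (β a) := fun a =>
    congrArg Subtype.val (e.apply_symm_apply ⟨φ (β a), hφβ a⟩)
  refine ⟨α, β, fun a b hab => hβ (hf.inj ?_), ?_⟩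
  · rw [← hα, hab, hα]
  · ext p
    rw [Subgroup.mem_inf, hmem, Subgroup.mem_map]
    constructor
    · rintro ⟨a, ha, rfl⟩
      refine ⟨⟨a, rfl⟩, ?_⟩
      change φ (β a) = β a
      rw [← hα]
      exact congrArg β ha
    · rintro ⟨⟨a, rfl⟩, ha⟩
      refine ⟨a, hβ ?_, rfl⟩
      rw [hα]
      exact ha

/-- The fixed subgroup of an injective endomorphism of a free product of `n` freely indecomposable
groups has rank at most `n * C`, where `C` bounds the ranks of the fixed subgroups of the injective
endomorphisms of the factors. -/
theorem exists_rank_fixedSubgroup_le [Fintype κ] (hind : ∀ i, FreelyIndecomposable (H i))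
    (hfg : ∀ i, Group.FG (H i))
    (hfix : ∀ (i : κ) (f : H i →* H i), Function.Injective f → Group.FG (fixedSubgroup f))
    {φ : CoprodI H →* CoprodI H} (hφ : Function.Injective φ) :
    ∃ h : Group.FG (fixedSubgroup φ), ∀ C : ℝ, 1 ≤ C →
      (∀ (i : κ) (f : H i →* H i) (hf : Function.Injective f),
        (@Group.rank _ _ (hfix i f hf) : ℝ) ≤ C) →
      (@Group.rank _ _ h : ℝ) ≤ Fintype.card κ * C := by
  classical
  let z : ∀ i, Option (H i ≃* Multiplicative ℤ) := fun i =>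
    if h : Nonempty (H i ≃* Multiplicative ℤ) then some h.some else none
  have hz : ∀ i, z i = none → ¬ Nonempty (H i ≃* Multiplicative ℤ) := fun i hi h => by
    simp [z, h] at hi
  obtain ⟨f, hf⟩ := exists_isTwist z hz hind hfg hφ
  obtain ⟨D, S, hD, hcard, hgen⟩ := hf.exists_generators
  have key : ∀ d : TreeVertex z, ∃ W : Finset (CoprodI H), d ∈ D →
      MulAction.stabilizer (CoprodI H) d ⊓ fixedSubgroup φ = Subgroup.closure (W : Set _) ∧
      ∀ C : ℝ, 1 ≤ C → (∀ (i : κ) (f : H i →* H i) (hf : Function.Injective f),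
        (@Group.rank _ _ (hfix i f hf) : ℝ) ≤ C) → (W.card : ℝ) ≤ C := by
    intro d
    by_cases hd : d ∈ D
    swap
    · exact ⟨∅, fun h => absurd h hd⟩
    rcases d with g | ⟨i, q⟩
    · refine ⟨∅, fun _ => ⟨?_, fun C hC _ => ?_⟩⟩
      · rw [stabilizer_inl, bot_inf_eq, Finset.coe_empty, Subgroup.closure_empty]
      · simpa using zero_le_one.trans hC
    · induction q using QuotientGroup.induction_on with
      | _ g =>
        obtain ⟨α, β, hα, hαβ⟩ := exists_map_fixedSubgroup hf (hD _ hd)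
        have hfgα := hfix i α hα
        obtain ⟨X, hX, hXc⟩ := Group.rank_spec (fixedSubgroup α)
        refine ⟨X.image (β.comp (fixedSubgroup α).subtype), fun _ => ⟨?_, fun C _ hC => ?_⟩⟩
        · rw [← hαβ, Finset.coe_image, ← MonoidHom.map_closure, hXc, ← Subgroup.map_map,
            ← MonoidHom.range_eq_map, Subgroup.range_subtype]
        · refine le_trans ?_ (hC i α hα)
          rw [← hX]
          exact_mod_cast Finset.card_image_le
  choose W hW using key
  have hgen' : fixedSubgroup φ = Subgroup.closure ((S ∪ D.biUnion W : Finset _) : Set _) := by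
    rw [hgen, Finset.coe_union, Subgroup.closure_union, Finset.coe_biUnion,
      Subgroup.closure_iUnion]
    congr 1
    refine iSup_congr fun d => ?_
    rw [Subgroup.closure_iUnion]
    exact iSup_congr fun hd => (hW d hd).1
  rw [hgen']
  refine ⟨(Group.fg_iff_subgroup_fg _).2 ⟨_, rfl⟩, fun C hC hCf => ?_⟩
  have h1 : Group.rank (Subgroup.closure ((S ∪ D.biUnion W : Finset _) : Set (CoprodI H))) ≤
      S.card + ∑ d ∈ D, (W d).card :=
    (Subgroup.rank_closure_finset_le_card _).trans
      ((Finset.card_union_le _ _).trans (Nat.add_le_add_left Finset.card_biUnion_le _))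
  have h2 : ∑ d ∈ D, ((W d).card : ℝ) ≤ D.card * C := by
    rw [← nsmul_eq_mul]
    exact Finset.sum_le_card_nsmul _ _ _ fun d hd => (hW d hd).2 C hC hCf
  have h3 : (D.card : ℝ) + S.card ≤ Fintype.card κ := by exact_mod_cast hcard
  have h4 : (S.card : ℝ) ≤ S.card * C := le_mul_of_one_le_right (Nat.cast_nonneg _) hC
  calc _ ≤ (S.card : ℝ) + ∑ d ∈ D, ((W d).card : ℝ) := by exact_mod_cast h1
    _ ≤ (D.card + S.card) * C := by linarith
    _ ≤ _ := mul_le_mul_of_nonneg_right h3 (by linarith)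

end Monoid.CoprodI

/-- If each freely indecomposable factor `Gᵢ` of `G = G₁ ∗ ⋯ ∗ G_n` satisfies
`rk(Fix(f)) ≤ kᵢ·rk(Gᵢ)` for all injective endomorphisms `f`, then every injective
endomorphism `φ` of `G` has finitely generated fixed subgroup with
`rk(Fix(φ)) ≤ n·(maxᵢ kᵢ)·(rk(G) − n + 1)`; if moreover all the `Gᵢ` have the same rank
then `rk(Fix(φ)) ≤ (maxᵢ kᵢ)·rk(G)`. Here by Grushko `rk(G) = Σᵢ rk(Gᵢ)`. -/
theorem fixedSubgroup_of_monomorphism_of_freeProduct_of_freelyIndecomposable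
    (n : ℕ) (hn : 0 < n) (G : Fin n → Type) [∀ i, Group (G i)] [∀ i, Group.FG (G i)]
    (hind : ∀ i, FreelyIndecomposable (G i)) (k : Fin n → ℝ) (hk : ∀ i, 0 ≤ k i)
    (hfix : ∀ (i : Fin n) (f : G i →* G i), Function.Injective f →
      ∃ h : Group.FG ↥(fixedSubgroup f),
        (@Group.rank _ _ h : ℝ) ≤ k i * Group.rank (G i))
    (φ : Monoid.CoprodI G →* Monoid.CoprodI G) (hφ : Function.Injective φ) :
    ∃ h : Group.FG ↥(fixedSubgroup φ),
      (@Group.rank _ _ h : ℝ) ≤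
        n * (Finset.univ.sup' (Finset.univ_nonempty_iff.mpr ⟨⟨0, hn⟩⟩) k) *
          ((∑ i, (Group.rank (G i) : ℝ)) - n + 1) ∧
      ((∀ i j, Group.rank (G i) = Group.rank (G j)) →
        (@Group.rank _ _ h : ℝ) ≤
          (Finset.univ.sup' (Finset.univ_nonempty_iff.mpr ⟨⟨0, hn⟩⟩) k) *
            (∑ i, (Group.rank (G i) : ℝ))) := by
  obtain ⟨h, hC⟩ := Monoid.CoprodI.exists_rank_fixedSubgroup_le hind (fun _ => inferInstance)
    (fun i f hf => (hfix i f hf).1) hφ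
  refine ⟨h, ?_⟩
  set M := Finset.univ.sup' (Finset.univ_nonempty_iff.mpr ⟨⟨0, hn⟩⟩) k
  have hkM : ∀ i, k i ≤ M := fun i => Finset.le_sup' k (Finset.mem_univ i)
  have hM : 0 ≤ M := (hk ⟨0, hn⟩).trans (hkM _)
  have hr : ∀ i, (1 : ℝ) ≤ Group.rank (G i) := fun i => by
    have := (hind i).1
    exact_mod_cast Group.rank_pos (G := G i)
  have hid : ∀ i, (Group.rank (G i) : ℝ) ≤ k i * Group.rank (G i) := fun i => by
    obtain ⟨h', hr'⟩ := hfix i (MonoidHom.id _) Function.injective_id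
    refine le_trans ?_ hr'
    have htop : fixedSubgroup (MonoidHom.id (G i)) = ⊤ := eq_top_iff.2 fun _ _ => rfl
    exact_mod_cast Group.rank_le_of_surjective (fixedSubgroup (MonoidHom.id (G i))).subtype
      fun a => ⟨⟨a, htop ▸ Subgroup.mem_top a⟩, rfl⟩
  have bound : ∀ R : ℝ, (∀ i, (Group.rank (G i) : ℝ) ≤ R) →
      (@Group.rank _ _ h : ℝ) ≤ n * (M * R) := by
    intro R hR
    have hMR : ∀ i, k i * Group.rank (G i) ≤ M * R := fun i =>
      mul_le_mul (hkM i) (hR i) (Nat.cast_nonneg _) hM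
    have := hC (M * R) ((hr ⟨0, hn⟩).trans ((hid _).trans (hMR _)))
      fun i f hf => (hfix i f hf).2.trans (hMR i)
    rwa [Fintype.card_fin] at this
  refine ⟨?_, fun heq => ?_⟩
  · rw [mul_assoc]
    refine bound _ fun i => ?_
    have h1 : ∑ j ∈ Finset.univ.erase i, (1 : ℝ) ≤
        ∑ j ∈ Finset.univ.erase i, (Group.rank (G j) : ℝ) :=
      Finset.sum_le_sum fun j _ => hr j
    rw [← Finset.add_sum_erase _ _ (Finset.mem_univ i)]
    rw [Finset.sum_const, Finset.card_erase_of_mem (Finset.mem_univ i), Finset.card_univ,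
      Fintype.card_fin, nsmul_eq_mul, mul_one, Nat.cast_pred hn] at h1
    linarith
  · have h2 : ∑ i, (Group.rank (G i) : ℝ) = n * Group.rank (G ⟨0, hn⟩) := by
      rw [Finset.sum_congr rfl fun i _ => congrArg Nat.cast (heq i ⟨0, hn⟩), Finset.sum_const,
        Finset.card_univ, Fintype.card_fin, nsmul_eq_mul]
    rw [h2, mul_left_comm]
    exact bound _ fun i => by rw [heq i ⟨0, hn⟩]
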